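/- arXiv:1103.5094 — 3 statements merged into one kernel-verified Lean document; each statement's English description precedes it below -/
import Mathlib

section
/- Let (M,d) be a non-empty complete metric space, (Y,‖·‖) a Banach space, π : M → Y continuous, and Θ : (0,∞) → (0,∞) with Θ(t) → 0 as t → 0⁺. Let g : Y → ℝ be Lipschitz, let D = {(x,e) ∈ M × (Y∖{0}) : the directional derivative g'(πx,e) exists}, and let (x₀,e₀) ∈ D with ‖e₀‖ = 1 and g'(πx₀,e₀) ≥ 0. Then there exist: (1) e₀* ∈ Y* with ‖e₀*‖ = e₀*(e₀) = 1, defining the Lipschitz function f = g + 2·Lip(g)·e₀*; (2) a norm ‖·‖' on Y with ‖y‖ ≤ ‖y‖' ≤ 2‖y‖ for all y ∈ Y; and (3) a pair (x̃,ẽ) ∈ D with ‖ẽ‖' = 1; such that f'(πx̃,ẽ) ≥ f'(πx₀,e₀) and for every ε > 0 there is an open neighbourhood N_ε of x̃ in M with the property: whenever (x',e') ∈ D with x' ∈ N_ε, ‖e'‖' = 1, f'(πx',e') > f'(πx̃,ẽ), and |(f(πx' + tẽ) − f(πx')) − (f(πx̃ + tẽ) − f(πx̃))| ≤ Θ(f'(πx',e')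 − f'(πx̃,ẽ))·|t| for all t ∈ ℝ, then f'(πx',e') < f'(πx̃,ẽ) + ε. Moreover, if ‖·‖ is Fréchet differentiable on Y∖{0} then ‖·‖' can be chosen Fréchet differentiable on Y∖{0}. -/
open Metric Set Filter

/-- The directional derivative `f'(y,e) = lim_{t→0} (f(y+te) − f(y))/t`. -/
def HasDirDeriv {Y : Type*} [NormedAddCommGroup Y] [NormedSpace ℝ Y]
    (f : Y → ℝ) (y e : Y) (L : ℝ) : Prop :=
  Tendsto (fun t : ℝ => (f (y + t • e) - f y) / t) (nhdsWithin 0 {(0:ℝ)}ᶜ) (nhds L)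

section helpers

variable {M Y : Type*} [MetricSpace M] [NormedAddCommGroup Y] [NormedSpace ℝ Y]

/-- Increments of `f` in direction `e` at `y` and `z` differ by at most `B|t|`. -/
def IncBd (f : Y → ℝ) (y z e : Y) (B : ℝ) : Prop :=
  ∀ t : ℝ, |(f (y + t • e) - f y) - (f (z + t • e) - f z)| ≤ B * |t|

theorem IncBd.mono {f : Y → ℝ} {y z e : Y} {B C : ℝ} (h : IncBd f y z e B) (hBC : B ≤ C) :
    IncBd f y z e C := fun t => (h t).trans (by gcongr)

theorem HasDirDeriv.exists_delta {f : Y → ℝ} {y e : Y} {L : ℝ} (h : HasDirDeriv f y e L)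
    {κ : ℝ} (hκ : 0 < κ) :
    ∃ Δ > 0, ∀ t : ℝ, |t| < Δ → |(f (y + t • e) - f y) - L * t| ≤ κ * |t| := by
  have h1 := (Metric.tendsto_nhdsWithin_nhds.1 h) κ hκ
  obtain ⟨Δ, hΔ, h2⟩ := h1
  refine ⟨Δ, hΔ, fun t ht => ?_⟩
  by_cases h0 : t = 0
  · simp [h0]
  have h3 := h2 (x := t) h0 (by simpa [Real.dist_eq] using ht)
  rw [Real.dist_eq] at h3
  have h4 : (f (y + t • e) - f y) - L * t = ((f (y + t • e) - f y) / t - L) * t := by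
    field_simp
  rw [h4, abs_mul]
  gcongr

theorem hasDirDeriv_of_forall {f : Y → ℝ} {y e : Y} {L : ℝ}
    (h : ∀ κ > 0, ∃ Δ > 0, ∀ t : ℝ, |t| < Δ → |(f (y + t • e) - f y) - L * t| ≤ κ * |t|) :
    HasDirDeriv f y e L := by
  refine Metric.tendsto_nhdsWithin_nhds.2 fun ε hε => ?_
  obtain ⟨Δ, hΔ, h2⟩ := h (ε / 2) (by positivity)
  refine ⟨Δ, hΔ, fun {t} h0 ht => ?_⟩
  have h0' : t ≠ 0 := h0
  have h3 := h2 t (by simpa [Real.dist_eq] using ht)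
  rw [Real.dist_eq]
  have h4 : (f (y + t • e) - f y) - L * t = ((f (y + t • e) - f y) / t - L) * t := by
    field_simp
  rw [h4, abs_mul] at h3
  have := le_of_mul_le_mul_right h3 (abs_pos.2 h0')
  linarith

theorem HasDirDeriv.le_of {f : Y → ℝ} {y e : Y} {L C : ℝ} (h : HasDirDeriv f y e L)
    (hC : ∀ t : ℝ, t ≠ 0 → (f (y + t • e) - f y) / t ≤ C) : L ≤ C :=
  le_of_tendsto h (eventually_mem_nhdsWithin.mono fun t ht => hC t ht)

theorem HasDirDeriv.le_lip {f : Y → ℝ} {K : ℝ} (hf : ∀ u v, |f u - f v| ≤ K * ‖u - v‖)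
    {y e : Y} {L : ℝ} (h : HasDirDeriv f y e L) : L ≤ K * ‖e‖ := by
  refine h.le_of fun t ht => ?_
  refine (le_abs_self _).trans ?_
  rw [abs_div, div_le_iff₀ (abs_pos.2 ht)]
  have := hf (y + t • e) y
  rw [add_sub_cancel_left, norm_smul, Real.norm_eq_abs] at this
  linarith

theorem HasDirDeriv.smul {f : Y → ℝ} {y e : Y} {L : ℝ} (h : HasDirDeriv f y e L)
    {c : ℝ} (hc : 0 < c) : HasDirDeriv f y (c • e) (c * L) := by
  refine hasDirDeriv_of_forall fun κ hκ => ?_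
  obtain ⟨Δ, hΔ, h2⟩ := h.exists_delta (κ := κ / c) (by positivity)
  refine ⟨Δ / c, by positivity, fun t ht => ?_⟩
  rw [lt_div_iff₀ hc] at ht
  have := h2 (t * c) (by rw [abs_mul, abs_of_pos hc]; exact ht)
  rw [abs_mul, abs_of_pos hc, mul_smul] at this
  convert this using 1
  · ring_nf
  · field_simp

theorem transfer {f : Y → ℝ} {K : ℝ} (hK : 0 ≤ K) (hf : ∀ u v, |f u - f v| ≤ K * ‖u - v‖)
    {b z e u : Y} {l m A κ : ℝ} (hb : HasDirDeriv f b e l) (hz : HasDirDeriv f z u m)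
    (hlm : l ≤ m) (hA : IncBd f z b e A) (hκ : 0 < κ) :
    ∃ r > 0, ∀ y, ‖y - z‖ < r → ∀ B, IncBd f y z u B → ∀ C, A + κ ≤ C →
      B + (m - l) + K * ‖u - e‖ + κ ≤ C → IncBd f y b e C := by
  obtain ⟨Δ₁, hΔ₁, h1⟩ := hb.exists_delta (half_pos hκ)
  obtain ⟨Δ₂, hΔ₂, h2⟩ := hz.exists_delta (half_pos hκ)
  refine ⟨κ * min Δ₁ Δ₂ / (2 * K + 1), by positivity, fun y hy B hB C hC1 hC2 t => ?_⟩
  rcases lt_or_ge |t| (min Δ₁ Δ₂) with ht | ht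
  · have e1 := h1 t (ht.trans_le (min_le_left _ _))
    have e2 := h2 t (ht.trans_le (min_le_right _ _))
    have e3 := hB t
    have e4 := hf (y + t • e) (y + t • u)
    have e5 : ‖(y + t • e) - (y + t • u)‖ = |t| * ‖u - e‖ := by
      rw [add_sub_add_left_eq_sub, ← smul_sub, norm_smul, Real.norm_eq_abs, norm_sub_rev]
    rw [e5] at e4
    have e6 : |(m - l) * t| = (m - l) * |t| := by
      rw [abs_mul, abs_of_nonneg (sub_nonneg.2 hlm)]
    have e7 := mul_le_mul_of_nonneg_right hC2 (abs_nonneg t)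
    refine le_trans ?_ e7
    have e6' := e6.le
    rw [abs_le] at *
    constructor <;> nlinarith
  · have e1 := hA t
    have e2 := hf (y + t • e) (z + t • e)
    have e3 := hf y z
    rw [add_sub_add_right_eq_sub] at e2
    rw [lt_div_iff₀ (by positivity)] at hy
    have e4 : κ * min Δ₁ Δ₂ ≤ κ * |t| := by gcongr
    have e7 := mul_le_mul_of_nonneg_right hC1 (abs_nonneg t)
    refine le_trans ?_ e7
    have := norm_nonneg (y - z)
    rw [abs_le] at *
    constructor <;> nlinarith

theorem exists_Omega (Θ : ℝ → ℝ) (hΘpos : ∀ t > (0:ℝ), 0 < Θ t)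
    (hΘ0 : Tendsto Θ (nhdsWithin 0 (Ioi 0)) (nhds 0)) (C : ℝ) (hC : 0 < C) :
    ∃ Ω : ℝ → ℝ, (∀ a b, 0 ≤ a → 0 ≤ b → a + Ω b ≤ Ω (a + b)) ∧ 0 ≤ Ω 0 ∧
      (∀ r > 0, min (Θ r) C ≤ Ω r) ∧
      (∀ ε > 0, ∃ η > 0, ∀ r, 0 ≤ r → r < η → Ω r ≤ ε) := by
  let S : ℝ → Set ℝ := fun s => (fun r => min (Θ r) C) '' (Ioc 0 s)
  have hbdd : ∀ s, BddAbove (S s) := fun s => ⟨C, by rintro _ ⟨r, -, rfl⟩; exact min_le_right _ _⟩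
  have hnn : ∀ s, 0 ≤ sSup (S s) := fun s => Real.sSup_nonneg (by
    rintro _ ⟨r, hr, rfl⟩
    exact le_min (hΘpos r hr.1).le hC.le)
  refine ⟨fun s => s + sSup (S s), ?_, ?_, ?_, ?_⟩
  · intro a b ha hb
    have : sSup (S b) ≤ sSup (S (a + b)) := by
      refine Real.sSup_le ?_ (hnn _)
      rintro _ ⟨r, hr, rfl⟩
      exact le_csSup (hbdd _) ⟨r, ⟨hr.1, by linarith [hr.2]⟩, rfl⟩
    simp only
    linarith
  · simpa using hnn 0
  · intro r hr
    have : min (Θ r) C ≤ sSup (S r) := le_csSup (hbdd _) ⟨r, ⟨hr, le_rfl⟩, rfl⟩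
    simp only
    linarith
  · intro ε hε
    obtain ⟨η, hη, h⟩ := Metric.tendsto_nhdsWithin_nhds.1 hΘ0 (ε / 2) (by positivity)
    refine ⟨min η (ε / 2), by positivity, fun r hr0 hr => ?_⟩
    have : sSup (S r) ≤ ε / 2 := by
      refine Real.sSup_le ?_ (by positivity)
      rintro _ ⟨q, hq, rfl⟩
      have := h (x := q) hq.1 (by
        rw [Real.dist_eq, sub_zero, abs_of_pos hq.1]
        exact lt_of_le_of_lt hq.2 (hr.trans_le (min_le_left _ _)))
      rw [Real.dist_eq, sub_zero] at this
      exact (min_le_left _ _).trans ((le_abs_self _).trans this.le)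
    have := hr.trans_le (min_le_right η (ε / 2))
    simp only
    linarith

/-- one norm step -/
noncomputable def stepNorm (φ : Y →L[ℝ] ℝ) (p : Y → ℝ) (e : Y) (τ : ℝ) (u : Y) : ℝ :=
  Real.sqrt (p u ^ 2 + τ * ‖u - (φ u / φ e) • e‖ ^ 2)

theorem stepNorm_sq (φ : Y →L[ℝ] ℝ) (p : Y → ℝ) (e : Y) (τ : ℝ) (hτ : 0 ≤ τ) (u : Y) :
    stepNorm φ p e τ u ^ 2 = p u ^ 2 + τ * ‖u - (φ u / φ e) • e‖ ^ 2 :=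
  Real.sq_sqrt (by positivity)

theorem stepNorm_ge (φ : Y →L[ℝ] ℝ) (p : Y → ℝ) (e : Y) (τ : ℝ) (hτ : 0 ≤ τ) (u : Y) :
    p u ≤ stepNorm φ p e τ u :=
  Real.le_sqrt_of_sq_le (by nlinarith [mul_nonneg hτ (sq_nonneg ‖u - (φ u / φ e) • e‖)])

theorem stepNorm_smul (φ : Y →L[ℝ] ℝ) (p : Y → ℝ) (hp : ∀ (a : ℝ) u, p (a • u) = |a| * p u)
    (e : Y) (τ : ℝ) (a : ℝ) (u : Y) :
    stepNorm φ p e τ (a • u) = |a| * stepNorm φ p e τ u := by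
  have h : a • u - (φ (a • u) / φ e) • e = a • (u - (φ u / φ e) • e) := by
    rw [smul_sub, smul_smul, map_smul, smul_eq_mul, mul_div_assoc]
  unfold stepNorm
  rw [h, hp, norm_smul, Real.norm_eq_abs]
  have : (|a| * p u) ^ 2 + τ * (|a| * ‖u - (φ u / φ e) • e‖) ^ 2
    = |a| ^ 2 * (p u ^ 2 + τ * ‖u - (φ u / φ e) • e‖ ^ 2) := by ring
  rw [this, Real.sqrt_mul (by positivity), Real.sqrt_sq (abs_nonneg a)]

theorem sqrt_mink {a b c d x y : ℝ} (ha : 0 ≤ a) (hb : 0 ≤ b) (hc : 0 ≤ c) (hd : 0 ≤ d)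
    (hx0 : 0 ≤ x) (hy0 : 0 ≤ y)
    (hx : x ≤ a + c) (hy : y ≤ b + d) :
    Real.sqrt (x ^ 2 + y ^ 2) ≤ Real.sqrt (a ^ 2 + b ^ 2) + Real.sqrt (c ^ 2 + d ^ 2) := by
  have h1 := Real.sq_sqrt (show 0 ≤ a ^ 2 + b ^ 2 by positivity)
  have h2 := Real.sq_sqrt (show 0 ≤ c ^ 2 + d ^ 2 by positivity)
  have h3 : a * c + b * d ≤ Real.sqrt (a ^ 2 + b ^ 2) * Real.sqrt (c ^ 2 + d ^ 2) := by
    rw [← Real.sqrt_mul (by positivity)]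
    refine Real.le_sqrt_of_sq_le ?_
    nlinarith [sq_nonneg (a * d - b * c)]
  rw [Real.sqrt_le_left (by positivity)]
  have h4 : x ^ 2 ≤ (a + c) ^ 2 := by gcongr
  have h5 : y ^ 2 ≤ (b + d) ^ 2 := by gcongr
  nlinarith

theorem stepNorm_add (φ : Y →L[ℝ] ℝ) (p : Y → ℝ) (hp0 : ∀ u, 0 ≤ p u)
    (hp : ∀ u v, p (u + v) ≤ p u + p v)
    (e : Y) (τ : ℝ) (hτ : 0 ≤ τ) (u v : Y) :
    stepNorm φ p e τ (u + v) ≤ stepNorm φ p e τ u + stepNorm φ p e τ v := by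
  have h : (u + v) - (φ (u + v) / φ e) • e
      = (u - (φ u / φ e) • e) + (v - (φ v / φ e) • e) := by
    rw [map_add, add_div, add_smul]; abel
  have h2 : ∀ w : Y, p w ^ 2 + τ * ‖w - (φ w / φ e) • e‖ ^ 2
      = p w ^ 2 + (Real.sqrt τ * ‖w - (φ w / φ e) • e‖) ^ 2 := by
    intro w; rw [mul_pow, Real.sq_sqrt hτ]
  unfold stepNorm
  rw [h2, h2, h2]
  refine sqrt_mink (hp0 _) (by positivity) (hp0 _) (by positivity) (hp0 _) (by positivity) (hp u v) ?_
  rw [h, ← mul_add]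
  gcongr
  exact norm_add_le _ _

theorem stepNorm_self (φ : Y →L[ℝ] ℝ) (p : Y → ℝ) (e : Y) (τ : ℝ) (h : φ e ≠ 0) (h0 : 0 ≤ p e) :
    stepNorm φ p e τ e = p e := by
  unfold stepNorm
  rw [div_self h, one_smul, sub_self, norm_zero]
  simpa using Real.sqrt_sq h0

theorem proj_norm_le (φ : Y →L[ℝ] ℝ) (hφ : ∀ u, |φ u| ≤ ‖u‖) (e : Y) (he : ‖e‖ ≤ 1)
    (hφe : 1 / 2 ≤ φ e) (u : Y) : ‖u - (φ u / φ e) • e‖ ≤ 3 * ‖u‖ := by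
  refine (norm_sub_le _ _).trans ?_
  rw [norm_smul, Real.norm_eq_abs, abs_div, abs_of_pos (by linarith : 0 < φ e)]
  have h1 : |φ u| / φ e ≤ 2 * ‖u‖ := by
    rw [div_le_iff₀ (by linarith)]
    nlinarith [hφ u, norm_nonneg u]
  have h2 : |φ u| / φ e * ‖e‖ ≤ 2 * ‖u‖ * 1 := by gcongr
  linarith

theorem dist_est (φ : Y →L[ℝ] ℝ) (p : Y → ℝ)
    (hadd : ∀ u v, p (u + v) ≤ p u + p v) (hsm : ∀ (a : ℝ) u, p (a • u) = |a| * p u)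
    (hge : ∀ u, ‖u‖ ≤ p u) (hle : ∀ u, p u ≤ 2 * ‖u‖)
    {e e' : Y} {l l' G τ ρ : ℝ} (hG : 0 < G) (hτ : 0 < τ) (hτ1 : τ ≤ 1) (hρ : 0 < ρ) (hρ1 : ρ ≤ 1)
    (hpe : p e = 1) (hφe : 1 / 2 ≤ φ e) (hφe' : 1 / 2 ≤ φ e') (hl : 2 * G ≤ l) (hll : l ≤ l')
    (hl' : l' ≤ (l + G * τ * ρ ^ 2) * p e') (h1 : stepNorm φ p e τ e' = 1) :
    ‖e' - e‖ ≤ 4 * ρ := by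
  have hsq := stepNorm_sq φ p e τ hτ.le e'
  rw [h1] at hsq
  set c := φ e' / φ e with hc
  have hc0 : 0 ≤ c := by apply div_nonneg <;> linarith
  set w := e' - c • e with hw
  set q := p e' with hq
  have hq0 : 0 ≤ q := (norm_nonneg _).trans (hge _)
  have hq1 : q ≤ 1 := by
    have := mul_nonneg hτ.le (sq_nonneg ‖w‖)
    nlinarith
  have h2 : 1 - q ≤ τ * ρ ^ 2 / 2 := by
    have a1 : l * (1 - q) ≤ G * τ * ρ ^ 2 * q := by nlinarith
    have a2 : 2 * G * (1 - q) ≤ l * (1 - q) := mul_le_mul_of_nonneg_right hl (by linarith)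
    have a3 : G * τ * ρ ^ 2 * q ≤ G * τ * ρ ^ 2 * 1 :=
      mul_le_mul_of_nonneg_left hq1 (by positivity)
    have a4 : G * (1 - q) ≤ G * (τ * ρ ^ 2 / 2) := by nlinarith
    exact le_of_mul_le_mul_left a4 hG
  have h3 : ‖w‖ ≤ ρ := by
    have a1 : τ * ‖w‖ ^ 2 ≤ τ * ρ ^ 2 := by nlinarith
    have a2 := le_of_mul_le_mul_left a1 hτ
    exact le_of_sq_le_sq a2 hρ.le
  have hpw : p w ≤ 2 * ρ := (hle w).trans (by linarith)
  have hce : p (c • e) = c := by rw [hsm, hpe, abs_of_nonneg hc0, mul_one]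
  have h4 : q ≤ p w + c := by
    have := hadd w (c • e)
    rwa [hce, hw, sub_add_cancel, ← hw] at this
  have h5 : c ≤ q + p w := by
    have := hadd e' ((-1 : ℝ) • w)
    rw [hsm] at this
    have a : e' + (-1 : ℝ) • w = c • e := by rw [hw]; module
    rw [a, hce] at this
    simpa using this
  have h6 : τ * ρ ^ 2 / 2 ≤ ρ := by
    have : τ * ρ ^ 2 ≤ 1 * ρ ^ 2 := by gcongr
    nlinarith
  have h7 : |c - 1| ≤ 3 * ρ := by rw [abs_le]; constructor <;> linarith
  have h8 : e' - e = w + (c - 1) • e := by rw [hw]; module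
  rw [h8]
  refine (norm_add_le _ _).trans ?_
  rw [norm_smul, Real.norm_eq_abs]
  have h9 : ‖e‖ ≤ 1 := hpe ▸ hge e
  have : |c - 1| * ‖e‖ ≤ 3 * ρ * 1 := by gcongr
  linarith

/-- standing assumptions -/
structure Ctx (π : M → Y) (f : Y → ℝ) (φ : Y →L[ℝ] ℝ) (Ω : ℝ → ℝ) (G K ρ l0 : ℝ) : Prop where
  hπ : Continuous π
  hG : 0 < G
  hK : 0 < K
  hρ : 0 < ρ
  hρ1 : ρ ≤ 1
  hKρ : 16 * (K * ρ) ≤ 1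
  hl0 : 2 * G ≤ l0
  hφ : ∀ u, |φ u| ≤ ‖u‖
  hf : ∀ u v, |f u - f v| ≤ K * ‖u - v‖
  hfφ : ∀ y e L, HasDirDeriv f y e L → L ≤ G * ‖e‖ + 2 * G * φ e
  hΩ : ∀ a b, 0 ≤ a → 0 ≤ b → a + Ω b ≤ Ω (a + b)
  hΩ0 : 0 ≤ Ω 0

/-- state of the construction -/
structure St (M Y : Type*) where
  x : M
  e : Y
  l : ℝ
  p : Y → ℝ
  adm : M → ℝ → Prop

/-- admissibility relative to a state -/
def Adm (π : M → Y) (f : Y → ℝ) (Ω : ℝ → ℝ) (σ δ : ℝ) (s : St M Y) (x : M) (L : ℝ) : Prop :=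
  dist x s.x < δ ∧ s.l ≤ L ∧ ∃ κ > 0, IncBd f (π x) (π s.x) s.e (σ + Ω (L - s.l) - κ)

/-- the tolerance in the choice of almost maximal pairs -/
noncomputable def nu (G ρ : ℝ) (n : ℕ) : ℝ := G * ((1/2) ^ n / 6) * (ρ * (1/2) ^ n) ^ 2

/-- invariant -/
structure StInv (π : M → Y) (f : Y → ℝ) (Ω : ℝ → ℝ) (G ρ l0 : ℝ) (n : ℕ) (s : St M Y) : Prop where
  add : ∀ u v, s.p (u + v) ≤ s.p u + s.p v
  smul : ∀ (a : ℝ) u, s.p (a • u) = |a| * s.p u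
  ge : ∀ u, ‖u‖ ≤ s.p u
  le : ∀ u, s.p u ^ 2 ≤ (4 - 3 * (1/2) ^ n) * ‖u‖ ^ 2
  pe : s.p s.e = 1
  der : HasDirDeriv f (π s.x) s.e s.l
  low : l0 ≤ s.l
  mx : ∀ x e L, s.adm x L → s.p e ≤ 1 → HasDirDeriv f (π x) e L →
    L ≤ (s.l + nu G ρ n) * s.p e
  op : ∃ δ > 0, ∀ x L, dist x s.x < δ → s.l ≤ L →
    IncBd f (π x) (π s.x) s.e ((1/2) ^ n + Ω (L - s.l)) → s.adm x L

/-- relation between consecutive states -/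
structure StStep (π : M → Y) (f : Y → ℝ) (φ : Y →L[ℝ] ℝ) (Ω : ℝ → ℝ) (ρ : ℝ) (n : ℕ)
    (s s' : St M Y) : Prop where
  p_eq : s'.p = stepNorm φ s.p s.e ((1/2) ^ n / 6)
  dist_e : ‖s'.e - s.e‖ ≤ 4 * (ρ * (1/2) ^ n)
  mem : s'.adm s'.x s'.l
  ex : ∃ δ > 0, δ ≤ (1/2) ^ n ∧ (∀ x L, dist x s.x < 2 * δ → s.l ≤ L →
    IncBd f (π x) (π s.x) s.e ((1/2) ^ n + Ω (L - s.l)) → s.adm x L) ∧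
    s'.adm = Adm π f Ω ((1/2) ^ n) δ s

section ctx
variable {π : M → Y} {f : Y → ℝ} {φ : Y →L[ℝ] ℝ} {Ω : ℝ → ℝ} {G K ρ l0 : ℝ}

theorem Ctx.l0_pos (c : Ctx π f φ Ω G K ρ l0) : 0 < l0 := by
  have := c.hG; have := c.hl0; linarith

theorem nu_pos (c : Ctx π f φ Ω G K ρ l0) (n : ℕ) : 0 < nu G ρ n := by
  have := c.hG; have := c.hρ
  unfold nu; positivity

theorem Ctx.phi_ge (c : Ctx π f φ Ω G K ρ l0) {y e : Y} {L : ℝ} (h : HasDirDeriv f y e L)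
    (he : ‖e‖ ≤ 1) (hL : l0 ≤ L) : 1 / 2 ≤ φ e := by
  have h1 := c.hfφ y e L h
  have h2 := c.hl0
  have h3 := c.hG
  have h4 : G * ‖e‖ ≤ G * 1 := by gcongr
  have h5 : G * (1/2) ≤ G * φ e := by linarith
  exact le_of_mul_le_mul_left h5 h3

theorem Ctx.mono_Omega (c : Ctx π f φ Ω G K ρ l0) {a b : ℝ} (ha : 0 ≤ a) (hab : a ≤ b) :
    Ω a ≤ Ω b := by
  have := c.hΩ (b - a) a (by linarith) ha
  rw [sub_add_cancel] at this; linarith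

theorem Adm.mono (c : Ctx π f φ Ω G K ρ l0) {σ δ : ℝ} {s : St M Y} {x : M} {L L' : ℝ}
    (h : Adm π f Ω σ δ s x L) (hL : L ≤ L') : Adm π f Ω σ δ s x L' := by
  obtain ⟨h1, h2, κ, hκ, h3⟩ := h
  refine ⟨h1, h2.trans hL, κ, hκ, h3.mono ?_⟩
  have := c.mono_Omega (sub_nonneg.2 h2) (sub_le_sub_right hL s.l)
  linarith

theorem choose_max (c : Ctx π f φ Ω G K ρ l0) (p : Y → ℝ)
    (hsm : ∀ (a : ℝ) u, p (a • u) = |a| * p u) (hge : ∀ u, ‖u‖ ≤ p u)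
    (adm : M → ℝ → Prop) (hmono : ∀ x L L', adm x L → L ≤ L' → adm x L')
    (hlow : ∀ x L, adm x L → l0 ≤ L)
    {x₁ : M} {e₁ : Y} {l₁ : ℝ} (h₁ : adm x₁ l₁) (h₁' : p e₁ = 1)
    (h₁'' : HasDirDeriv f (π x₁) e₁ l₁) {ν : ℝ} (hν : 0 < ν) :
    ∃ x e l, adm x l ∧ p e = 1 ∧ HasDirDeriv f (π x) e l ∧
      ∀ x' e' L, adm x' L → p e' ≤ 1 → HasDirDeriv f (π x') e' L → L ≤ (l + ν) * p e' := by
  let S : Set ℝ := {L | ∃ x e, adm x L ∧ p e = 1 ∧ HasDirDeriv f (π x) e L}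
  have hne : S.Nonempty := ⟨l₁, x₁, e₁, h₁, h₁', h₁''⟩
  have hbd : BddAbove S := by
    refine ⟨K, ?_⟩
    rintro L ⟨x, e, -, he, hd⟩
    refine (hd.le_lip c.hf).trans ?_
    have := hge e
    have := c.hK
    nlinarith
  obtain ⟨l, ⟨x, e, ha, he, hd⟩, hl⟩ := exists_lt_of_lt_csSup hne (sub_lt_self (sSup S) hν)
  refine ⟨x, e, l, ha, he, hd, fun x' e' L hL hp hd' => ?_⟩
  have hL0 : 0 < L := c.l0_pos.trans_le (hlow _ _ hL)
  have hp0 : 0 < p e' := by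
    refine lt_of_lt_of_le ?_ (hge e')
    have := hd'.le_lip c.hf
    by_contra hcon
    have h0 : ‖e'‖ = 0 := le_antisymm (not_lt.1 hcon) (norm_nonneg _)
    rw [h0] at this
    linarith
  have hmem : (p e')⁻¹ * L ∈ S := by
    refine ⟨x', (p e')⁻¹ • e', hmono _ _ _ hL ?_, ?_, hd'.smul (by positivity)⟩
    · have : 1 ≤ (p e')⁻¹ := (one_le_inv₀ hp0).2 hp
      nlinarith
    · rw [hsm, abs_of_pos (by positivity), inv_mul_cancel₀ hp0.ne']
  have h2 := le_csSup hbd hmem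
  have h3 : (p e')⁻¹ * L ≤ l + ν := by linarith
  rwa [inv_mul_le_iff₀ hp0, mul_comm] at h3

theorem StInv.le2 {n : ℕ} {s : St M Y} (h : StInv π f Ω G ρ l0 n s) (u : Y) : s.p u ≤ 2 * ‖u‖ := by
  refine le_of_sq_le_sq ((h.le u).trans ?_) (by positivity)
  have : (0:ℝ) ≤ (1/2) ^ n := by positivity
  nlinarith [mul_nonneg this (sq_nonneg ‖u‖)]

theorem StInv.norm_e {n : ℕ} {s : St M Y} (h : StInv π f Ω G ρ l0 n s) : ‖s.e‖ ≤ 1 := h.pe ▸ h.ge s.e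

theorem exists_step (c : Ctx π f φ Ω G K ρ l0) (n : ℕ) (s : St M Y)
    (h : StInv π f Ω G ρ l0 n s) :
    ∃ s', StInv π f Ω G ρ l0 (n + 1) s' ∧ StStep π f φ Ω ρ n s s' := by
  obtain ⟨δ₀, hδ₀, hop⟩ := h.op
  have hs : (0:ℝ) < (1/2) ^ n := by positivity
  have hs1 : ((1:ℝ)/2) ^ n ≤ 1 := pow_le_one₀ (by norm_num) (by norm_num)
  have hsucc : ((1:ℝ)/2) ^ (n + 1) = (1/2) ^ n / 2 := by rw [pow_succ]; ring
  set σ : ℝ := (1/2) ^ n with hσ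
  set δ := min (δ₀ / 2) σ with hδ
  have hδpos : 0 < δ := by positivity
  have hδ2 : 2 * δ ≤ δ₀ := by have := min_le_left (δ₀ / 2) σ; linarith
  have hφe := c.phi_ge h.der h.norm_e h.low
  have hτ : 0 ≤ σ / 6 := by positivity
  set p' := stepNorm φ s.p s.e (σ / 6) with hp'
  have hp0 : ∀ u, 0 ≤ s.p u := fun u => (norm_nonneg _).trans (h.ge u)
  have hsm' : ∀ (a : ℝ) u, p' (a • u) = |a| * p' u := stepNorm_smul φ s.p h.smul s.e _
  have hge' : ∀ u, s.p u ≤ p' u := stepNorm_ge φ s.p s.e _ hτ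
  obtain ⟨x', e', l', ha, he, hd, hmx⟩ := choose_max c p' hsm' (fun u => (h.ge u).trans (hge' u))
    (Adm π f Ω σ δ s) (fun x L L' hA hL => hA.mono c hL) (fun x L hA => h.low.trans hA.2.1)
    (x₁ := s.x) (e₁ := s.e) (l₁ := s.l)
    ⟨by simpa using hδpos, le_rfl, σ, hs, fun t => by
      have := c.hΩ0
      simp only [sub_self, abs_zero]
      have h0 : 0 ≤ (σ + Ω 0 - σ) := by linarith
      positivity⟩
    ((stepNorm_self φ s.p s.e _ (by linarith) (hp0 _)).trans h.pe) h.der (nu_pos c (n + 1))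
  have hsadm : s.adm x' l' := by
    obtain ⟨h1, h2, κ, hκ, h3⟩ := ha
    exact hop _ _ (by linarith) h2 (h3.mono (by linarith))
  have hpe' : s.p e' ≤ 1 := he ▸ hge' e'
  have hl' : l' ≤ (s.l + nu G ρ n) * s.p e' := h.mx x' e' l' hsadm hpe' hd
  have hne' : ‖e'‖ ≤ 1 := (h.ge e').trans hpe'
  have hφe' := c.phi_ge hd hne' (h.low.trans ha.2.1)
  have hρ := c.hρ
  have hdist : ‖e' - s.e‖ ≤ 4 * (ρ * σ) := by
    refine dist_est φ s.p h.add h.smul h.ge h.le2 c.hG (τ := σ / 6) (by positivity) (by linarith)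
      (by positivity) ?_ h.pe hφe hφe' (c.hl0.trans h.low) ha.2.1 hl' he
    have := c.hρ1
    nlinarith
  refine ⟨⟨x', e', l', p', Adm π f Ω σ δ s⟩, ?_, ?_⟩
  · refine ⟨?_, hsm', fun u => (h.ge u).trans (hge' u), ?_, he, hd, h.low.trans ha.2.1, hmx, ?_⟩
    · exact stepNorm_add φ s.p hp0 h.add s.e _ hτ
    · intro u
      have h1 := stepNorm_sq φ s.p s.e _ hτ u
      have h2 := h.le u
      have h3 := proj_norm_le φ c.hφ s.e h.norm_e hφe u
      have h4 : ‖u - (φ u / φ s.e) • s.e‖ ^ 2 ≤ (3 * ‖u‖) ^ 2 := by gcongr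
      have h5 : σ / 6 * ‖u - (φ u / φ s.e) • s.e‖ ^ 2 ≤ σ / 6 * (3 * ‖u‖) ^ 2 := by gcongr
      rw [hsucc]
      change p' u ^ 2 ≤ _
      rw [hp', h1]
      rw [← hσ] at h2
      nlinarith
    · obtain ⟨h1, h2, κ, hκ, h3⟩ := ha
      obtain ⟨r, hr, htr⟩ := transfer c.hK.le c.hf h.der hd h2 h3
        (κ := min (κ / 2) (σ / 16)) (by positivity)
      have hk1 := min_le_left (κ / 2) (σ / 16)
      have hk2 := min_le_right (κ / 2) (σ / 16)
      set k := min (κ / 2) (σ / 16) with hk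
      have hkpos : 0 < k := by positivity
      obtain ⟨r', hr', hc⟩ := Metric.continuous_iff.1 c.hπ x' r hr
      refine ⟨min r' (δ - dist x' s.x), lt_min hr' (by linarith), fun x L hx hL hB => ?_⟩
      refine ⟨?_, h2.trans hL, k, hkpos, ?_⟩
      · have := hx.trans_le (min_le_right _ _)
        have := dist_triangle x x' s.x
        simp only at *
        linarith
      · refine htr (π x) ?_ _ hB _ ?_ ?_
        · rw [← dist_eq_norm]
          exact hc x (hx.trans_le (min_le_left _ _))
        · have := c.mono_Omega (sub_nonneg.2 h2) (sub_le_sub_right hL s.l)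
          simp only at *
          linarith
        · have a1 := c.hΩ (l' - s.l) (L - l') (by linarith) (sub_nonneg.2 hL)
          have a2 : l' - s.l + (L - l') = L - s.l := by ring
          rw [a2] at a1
          have a3 : K * ‖e' - s.e‖ ≤ K * (4 * (ρ * σ)) := by
            have := c.hK
            gcongr
          have a4 : 16 * (K * ρ) * σ ≤ 1 * σ := by
            have := c.hKρ
            gcongr
          rw [hsucc]
          simp only at *
          nlinarith
  · exact ⟨rfl, hdist, ha, δ, hδpos, min_le_right _ _,
      fun x L hx => hop x L (hx.trans_le hδ2), rfl⟩

theorem exists_seq (c : Ctx π f φ Ω G K ρ l0) (x₀ : M) (e₀ : Y) (he₀ : ‖e₀‖ = 1)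
    (hd₀ : HasDirDeriv f (π x₀) e₀ l0) :
    ∃ s : ℕ → St M Y, (s 0).p = (fun u => ‖u‖) ∧ (∀ n, StInv π f Ω G ρ l0 n (s n)) ∧
      ∀ n, StStep π f φ Ω ρ n (s n) (s (n + 1)) := by
  obtain ⟨x, e, l, ha, he, hd, hmx⟩ := choose_max c (fun u : Y => ‖u‖)
    (fun a u => by rw [norm_smul, Real.norm_eq_abs]) (fun u => le_rfl)
    (fun (_ : M) L => l0 ≤ L) (fun x L L' => le_trans) (fun x L h => h) (x₁ := x₀) le_rfl he₀ hd₀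
    (nu_pos c 0)
  let s0 : St M Y := ⟨x, e, l, fun u => ‖u‖, fun _ L => l0 ≤ L⟩
  have h0 : StInv π f Ω G ρ l0 0 s0 := by
    refine ⟨norm_add_le, fun a u => by simp only [s0, norm_smul, Real.norm_eq_abs],
      fun u => le_rfl, fun u => ?_, he, hd, ha, hmx, 1, one_pos, fun x L _ hL _ => le_trans ha hL⟩
    simp only [s0]
    norm_num
  let T : ∀ n : ℕ, {s : St M Y // StInv π f Ω G ρ l0 n s} := fun n =>
    Nat.rec (motive := fun n => {s : St M Y // StInv π f Ω G ρ l0 n s}) ⟨s0, h0⟩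
      (fun n s => ⟨(exists_step c n s.1 s.2).choose, (exists_step c n s.1 s.2).choose_spec.1⟩) n
  exact ⟨fun n => (T n).1, rfl, fun n => (T n).2,
    fun n => (exists_step c n (T n).1 (T n).2).choose_spec.2⟩

theorem limit_norm (φ : Y →L[ℝ] ℝ) (hφ : ∀ u, |φ u| ≤ ‖u‖) (e : ℕ → Y) (he : ∀ n, ‖e n‖ ≤ 1)
    (hφe : ∀ n, 1 / 2 ≤ φ (e n)) (p : ℕ → Y → ℝ) (hp0 : p 0 = fun u => ‖u‖)
    (hpn : ∀ n u, 0 ≤ p n u)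
    (hps : ∀ n, p (n + 1) = stepNorm φ (p n) (e n) ((1/2) ^ n / 6)) :
    ∃ N : Y → ℝ, (∀ u, Tendsto (fun n => p n u) atTop (nhds (N u))) ∧
      ((∀ u : Y, u ≠ 0 → DifferentiableAt ℝ (fun v : Y => ‖v‖) u) →
        ∀ u : Y, u ≠ 0 → DifferentiableAt ℝ N u) := by
  have hτ : ∀ n : ℕ, (0:ℝ) ≤ (1/2) ^ n / 6 := fun n => by positivity
  have hτs : Summable (fun n : ℕ => ((1:ℝ)/2) ^ n / 6) := summable_geometric_two.div_const 6
  let ψ : ℕ → Y → ℝ := fun k u => (1/2) ^ k / 6 * ‖u - (φ u / φ (e k)) • e k‖ ^ 2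
  have hψ0 : ∀ k u, 0 ≤ ψ k u := fun k u => by positivity
  have hT := fun k u => proj_norm_le φ hφ (e k) (he k) (hφe k) u
  have hψs : ∀ u, Summable (fun k => ψ k u) := fun u => by
    refine Summable.of_nonneg_of_le (fun k => hψ0 k u) (fun k => ?_)
      (hτs.mul_right ((3 * ‖u‖) ^ 2))
    have := hT k u
    have := hτ k
    simp only [ψ]
    gcongr
  have hsq : ∀ n u, p n u ^ 2 = ‖u‖ ^ 2 + ∑ k ∈ Finset.range n, ψ k u := by
    intro n u
    induction n with
    | zero => simp [hp0]
    | succ n ih =>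
      rw [hps, stepNorm_sq _ _ _ _ (hτ n), ih, Finset.sum_range_succ, add_assoc]
  refine ⟨fun u => Real.sqrt (‖u‖ ^ 2 + ∑' k, ψ k u), fun u => ?_, fun hd u hu => ?_⟩
  · have h1 : (fun n => p n u)
        = fun n => Real.sqrt (‖u‖ ^ 2 + ∑ k ∈ Finset.range n, ψ k u) := by
      funext n
      rw [← hsq, Real.sqrt_sq (hpn n u)]
    rw [h1]
    exact (Real.continuous_sqrt.tendsto _).comp
      (((hψs u).hasSum.tendsto_sum_nat).const_add _)
  · have hq : Differentiable ℝ (fun v : Y => ‖v‖ ^ 2) := by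
      intro v
      by_cases hv : v = 0
      · subst hv
        have : HasFDerivAt (fun v : Y => ‖v‖ ^ 2) (0 : Y →L[ℝ] ℝ) 0 := by
          rw [hasFDerivAt_iff_isLittleO_nhds_zero]
          simp only [zero_add, norm_zero, ContinuousLinearMap.zero_apply, sub_zero]
          simpa using Asymptotics.isLittleO_norm_pow_id (E' := Y) one_lt_two
        exact this.differentiableAt
      · exact (hd v hv).pow 2
    let T : ℕ → Y →L[ℝ] Y := fun k =>
      ContinuousLinearMap.id ℝ Y - φ.smulRight ((φ (e k))⁻¹ • e k)
    have hTe : ∀ k v, T k v = v - (φ v / φ (e k)) • e k := by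
      intro k v
      simp [T, smul_smul, div_eq_mul_inv]
    have hψd : ∀ k, Differentiable ℝ (ψ k) := by
      intro k
      have : ψ k = fun u => (1/2) ^ k / 6 * ((fun v : Y => ‖v‖ ^ 2) (T k u)) := by
        funext u
        simp only [ψ, hTe]
      rw [this]
      exact (hq.comp (T k).differentiable).const_mul _
    set R := ‖u‖ + 1 with hR
    have hR0 : 0 < R := by positivity
    have hts : DifferentiableAt ℝ (fun v => ∑' k, ψ k v) u := by
      refine (hasFDerivAt_tsum_of_isPreconnected (s := ball (0:Y) R) (x₀ := u) (x := u)
        (f' := fun k v => fderiv ℝ (ψ k) v)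
        (hτs.mul_right (18 * R)) isOpen_ball (convex_ball _ _).isPreconnected
        (fun k v _ => (hψd k v).hasFDerivAt) ?_ (by simp [hR]) (hψs u)
        (by simp [hR])).differentiableAt
      intro k v hv
      refine norm_fderiv_le_of_lip' ℝ (by positivity) ?_
      filter_upwards [isOpen_ball.mem_nhds hv] with w hw
      have a1 : ‖T k w‖ ≤ 3 * ‖w‖ := by rw [hTe]; exact hT k w
      have a2 : ‖T k v‖ ≤ 3 * ‖v‖ := by rw [hTe]; exact hT k v
      have a3 : ‖T k (w - v)‖ ≤ 3 * ‖w - v‖ := by rw [hTe]; exact hT k (w - v)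
      rw [map_sub] at a3
      have a4 := abs_norm_sub_norm_le (T k w) (T k v)
      have hw' : ‖w‖ < R := by simpa using hw
      have hv' : ‖v‖ < R := by simpa using hv
      have e1 : ψ k w - ψ k v = (1/2) ^ k / 6 * ((‖T k w‖ + ‖T k v‖) * (‖T k w‖ - ‖T k v‖)) := by
        simp only [ψ, hTe]; ring
      rw [e1, Real.norm_eq_abs, abs_mul, abs_of_nonneg (hτ k), abs_mul,
        abs_of_nonneg (by positivity : 0 ≤ ‖T k w‖ + ‖T k v‖), mul_assoc]
      have := hτ k
      have a5 : (‖T k w‖ + ‖T k v‖) * |‖T k w‖ - ‖T k v‖| ≤ (6 * R) * (3 * ‖w - v‖) := by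
        gcongr
        · linarith
        · linarith
      refine mul_le_mul_of_nonneg_left (a5.trans (by linarith)) this
    refine ((hq u).add hts).sqrt ?_
    have : 0 ≤ ∑' k, ψ k u := tsum_nonneg fun k => hψ0 k u
    have h2 : 0 < ‖u‖ ^ 2 := by have := norm_pos_iff.2 hu; positivity
    exact (add_pos_of_pos_of_nonneg h2 this).ne'

theorem core [CompleteSpace M] [CompleteSpace Y] (c : Ctx π f φ Ω G K ρ l0) (x₀ : M) (e₀ : Y)
    (he₀ : ‖e₀‖ = 1) (hd₀ : HasDirDeriv f (π x₀) e₀ l0)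
    (Θ : ℝ → ℝ) (hΘ : ∀ r > 0, min (Θ r) (2 * K) ≤ Ω r)
    (hΩt : ∀ ε > 0, ∃ η > 0, ∀ r, 0 ≤ r → r < η → Ω r ≤ ε) :
    ∃ N : Y → ℝ,
      (∀ u v : Y, N (u + v) ≤ N u + N v) ∧
      (∀ (a : ℝ) (u : Y), N (a • u) = |a| * N u) ∧
      (∀ u : Y, N u = 0 → u = 0) ∧
      (∀ u : Y, ‖u‖ ≤ N u ∧ N u ≤ 2 * ‖u‖) ∧
      ((∀ u : Y, u ≠ 0 → DifferentiableAt ℝ (fun v : Y => ‖v‖) u) →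
        ∀ u : Y, u ≠ 0 → DifferentiableAt ℝ N u) ∧
      ∃ (xt : M) (et : Y) (Lf : ℝ),
        N et = 1 ∧
        HasDirDeriv f (π xt) et Lf ∧
        l0 ≤ Lf ∧
        ∀ ε > (0:ℝ), ∃ Nε : Set M, IsOpen Nε ∧ xt ∈ Nε ∧
          ∀ (x' : M) (e' : Y) (L' : ℝ), x' ∈ Nε → N e' = 1 →
            HasDirDeriv f (π x') e' L' → Lf < L' →
            (∀ t : ℝ, |(f (π x' + t • et) - f (π x')) -
                (f (π xt + t • et) - f (π xt))| ≤ Θ (L' - Lf) * |t|) →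
            L' < Lf + ε := by
  obtain ⟨s, hs0, hI, hS⟩ := exists_seq c x₀ e₀ he₀ hd₀
  have hp0 : ∀ n u, 0 ≤ (s n).p u := fun n u => (norm_nonneg _).trans ((hI n).ge u)
  have hφe := fun n => c.phi_ge (hI n).der (hI n).norm_e (hI n).low
  obtain ⟨N, hN, hNd⟩ := limit_norm φ c.hφ (fun n => (s n).e) (fun n => (hI n).norm_e) hφe
    (fun n => (s n).p) hs0 hp0 (fun n => (hS n).p_eq)
  have hpm : ∀ u, Monotone (fun n => (s n).p u) := fun u => monotone_nat_of_le_succ fun n => by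
    rw [(hS n).p_eq]
    exact stepNorm_ge φ _ _ _ (by positivity) u
  have hpN : ∀ n u, (s n).p u ≤ N u := fun n u => (hpm u).ge_of_tendsto (hN u) n
  have hNge : ∀ u, ‖u‖ ≤ N u := fun u => ((hI 0).ge u).trans (hpN 0 u)
  choose δ hδ hδs hop hadm using fun n => (hS n).ex
  have hnest1 : ∀ n x L, (s (n + 1)).adm x L → (s n).adm x L := by
    intro n x L h
    rw [hadm n] at h
    obtain ⟨h1, h2, κ, hκ, h3⟩ := h
    exact hop n x L (by linarith [hδ n]) h2 (h3.mono (by linarith))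
  have hnest : ∀ n k x L, (s (n + k)).adm x L → (s n).adm x L := by
    intro n k x L
    induction k with
    | zero => exact id
    | succ k ih => exact fun h => ih (hnest1 _ _ _ h)
  have hmem : ∀ n m, n < m → Adm π f Ω ((1/2) ^ n) (δ n) (s n) (s m).x (s m).l := by
    intro n m hnm
    obtain ⟨k, rfl⟩ := Nat.exists_eq_add_of_le (Nat.succ_le_of_lt hnm)
    rw [← hadm n]
    refine hnest (n + 1) k _ _ ?_
    have := (hS (n + k)).mem
    rwa [show n + 1 + k = n + k + 1 by ring]
  have hlm : Monotone (fun n => (s n).l) := monotone_nat_of_le_succ fun n =>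
    (hmem n (n + 1) n.lt_succ_self).2.1
  have hlK : ∀ n, (s n).l ≤ K := fun n => by
    have h1 := (hI n).der.le_lip c.hf
    have h2 := (hI n).norm_e
    have := c.hK
    nlinarith
  obtain ⟨Lf, hLf⟩ : ∃ Lf, Tendsto (fun n => (s n).l) atTop (nhds Lf) :=
    ⟨_, tendsto_atTop_ciSup hlm ⟨K, by rintro _ ⟨n, rfl⟩; exact hlK n⟩⟩
  have hlLf : ∀ n, (s n).l ≤ Lf := fun n => hlm.ge_of_tendsto hLf n
  -- limit point
  have hxd : ∀ n, dist (s n).x (s (n + 1)).x ≤ 1 * (1/2 : ℝ) ^ n := fun n => by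
    rw [one_mul, dist_comm]
    exact ((hmem n (n + 1) n.lt_succ_self).1.le).trans (hδs n)
  obtain ⟨xt, hxt⟩ := cauchySeq_tendsto_of_complete
    (cauchySeq_of_le_geometric (1/2 : ℝ) 1 (by norm_num) hxd)
  have hed : ∀ n, dist (s n).e (s (n + 1)).e ≤ (4 * ρ) * (1/2 : ℝ) ^ n := fun n => by
    rw [dist_comm, dist_eq_norm, mul_assoc]
    exact (hS n).dist_e
  obtain ⟨et, het⟩ := cauchySeq_tendsto_of_complete
    (cauchySeq_of_le_geometric (1/2 : ℝ) (4 * ρ) (by norm_num) hed)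
  have hetd : ∀ n, K * ‖et - (s n).e‖ ≤ (1/2) ^ n / 2 := fun n => by
    have h1 := dist_le_of_le_geometric_of_tendsto (1/2 : ℝ) (4 * ρ) (by norm_num) hed het n
    rw [dist_comm, dist_eq_norm] at h1
    have h2 : 4 * ρ * (1 / 2) ^ n / (1 - 1 / 2) = 8 * ρ * (1/2) ^ n := by ring
    rw [h2] at h1
    have hK := c.hK
    have h3 : K * ‖et - (s n).e‖ ≤ K * (8 * ρ * (1/2) ^ n) := by gcongr
    have h4 := c.hKρ
    have h5 : (0:ℝ) < (1/2) ^ n := by positivity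
    nlinarith
  have hxtd : ∀ n, dist xt (s n).x ≤ δ n := fun n =>
    le_of_tendsto (hxt.dist tendsto_const_nhds)
      ((eventually_gt_atTop n).mono fun m hm => (hmem n m hm).1.le)
  have hinc : ∀ n, IncBd f (π xt) (π (s n).x) (s n).e ((1/2) ^ n + Ω (Lf - (s n).l)) := by
    intro n t
    have hfc : Continuous f := by
      have : LipschitzWith ⟨K, c.hK.le⟩ f := LipschitzWith.of_dist_le_mul fun u v => by
        rw [Real.dist_eq, dist_eq_norm]; exact c.hf u v
      exact this.continuous
    have hcont : Continuous (fun x : M => |(f (π x + t • (s n).e) - f (π x)) -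
        (f (π (s n).x + t • (s n).e) - f (π (s n).x))|) := by
      have := c.hπ
      fun_prop
    refine le_of_tendsto ((hcont.tendsto xt).comp hxt)
      ((eventually_gt_atTop n).mono fun m hm => ?_)
    obtain ⟨h1, h2, κ, hκ, h3⟩ := hmem n m hm
    refine (h3.mono ?_) t
    have := c.mono_Omega (sub_nonneg.2 h2) (sub_le_sub_right (hlLf m) (s n).l)
    linarith
  have hhalf : Tendsto (fun n : ℕ => ((1:ℝ)/2) ^ n) atTop (nhds 0) :=
    tendsto_pow_atTop_nhds_zero_of_lt_one (by norm_num) (by norm_num)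
  have hder : HasDirDeriv f (π xt) et Lf := by
    refine hasDirDeriv_of_forall fun κ hκ => ?_
    obtain ⟨η, hη, hΩη⟩ := hΩt (κ / 8) (by positivity)
    have hη' : 0 < min η (κ / 8) := by positivity
    obtain ⟨n, hn1, hn2⟩ := ((hLf.eventually_const_lt (show Lf - min η (κ / 8) < Lf by linarith)).and
      (hhalf.eventually_lt_const (show (0:ℝ) < κ / 8 by positivity))).exists
    obtain ⟨Δ, hΔ, hDer⟩ := (hI n).der.exists_delta (κ := κ / 8) (by positivity)
    refine ⟨Δ, hΔ, fun t ht => ?_⟩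
    have m1 := min_le_left η (κ / 8)
    have m2 := min_le_right η (κ / 8)
    have b1 := hinc n t
    have b2 := hDer t ht
    have b3 := c.hf (π xt + t • et) (π xt + t • (s n).e)
    have b4 : ‖(π xt + t • et) - (π xt + t • (s n).e)‖ = |t| * ‖et - (s n).e‖ := by
      rw [add_sub_add_left_eq_sub, ← smul_sub, norm_smul, Real.norm_eq_abs]
    rw [b4] at b3
    have b5 := hΩη (Lf - (s n).l) (sub_nonneg.2 (hlLf n)) (by linarith)
    have b6 : |(Lf - (s n).l) * t| ≤ κ / 8 * |t| := by
      rw [abs_mul, abs_of_nonneg (sub_nonneg.2 (hlLf n))]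
      gcongr
      linarith
    have b7 := hetd n
    have ht0 := abs_nonneg t
    have b8 : ((1/2) ^ n + Ω (Lf - (s n).l)) * |t| ≤ (κ / 4) * |t| := by gcongr; linarith
    have b9 : K * (|t| * ‖et - (s n).e‖) ≤ κ / 16 * |t| := by
      rw [← mul_assoc, mul_comm K, mul_assoc, mul_comm]
      gcongr; linarith
    have b1' := b1.trans b8
    have b3' := b3.trans b9
    have hkt : 0 ≤ κ * |t| := by positivity
    rw [abs_le] at *
    constructor <;> linarith
  have hNsmul : ∀ (a : ℝ) (u : Y), N (a • u) = |a| * N u := fun a u =>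
    tendsto_nhds_unique (hN (a • u)) (by
      simp only [fun n => (hI n).smul a u]
      exact (hN u).const_mul _)
  have hNet : N et = 1 := by
    refine tendsto_nhds_unique (hN et) ?_
    rw [tendsto_iff_dist_tendsto_zero]
    have h0 : Tendsto (fun n => 2 * dist (s n).e et) atTop (nhds 0) := by
      simpa using (tendsto_iff_dist_tendsto_zero.1 het).const_mul 2
    refine squeeze_zero (fun _ => dist_nonneg) (fun n => ?_) h0
    rw [Real.dist_eq, dist_eq_norm]
    have h1 := (hI n).add et ((s n).e - et)
    have h2 := (hI n).add (s n).e ((-1 : ℝ) • ((s n).e - et))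
    have h3 := (hI n).le2 ((s n).e - et)
    rw [(hI n).smul] at h2
    rw [add_sub_cancel, (hI n).pe] at h1
    rw [(hI n).pe, show (s n).e + (-1 : ℝ) • ((s n).e - et) = et by module] at h2
    rw [abs_neg, abs_one] at h2
    rw [abs_le]
    constructor <;> linarith
  refine ⟨N, fun u v => ?_, hNsmul, fun u hu => ?_, fun u => ⟨hNge u, ?_⟩, hNd, xt, et, Lf, hNet,
    hder, (hI 0).low.trans (hlLf 0), fun ε hε => ?_⟩
  · exact le_of_tendsto_of_tendsto' (hN _) ((hN u).add (hN v)) fun n => (hI n).add u v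
  · exact norm_le_zero_iff.1 (hu ▸ hNge u)
  · exact le_of_tendsto' (hN u) fun n => (hI n).le2 u
  -- maximality
  have hnu0 : Tendsto (fun n => nu G ρ n) atTop (nhds 0) := by
    have := ((hhalf.div_const 6).const_mul G).mul ((hhalf.const_mul ρ).pow 2)
    simpa [nu] using this
  obtain ⟨n, hn⟩ := (hnu0.eventually_lt_const hε).exists
  have hσ : (0:ℝ) < (1/2) ^ n := by positivity
  have hlip := hetd n
  set σ : ℝ := (1/2) ^ n with hσd
  obtain ⟨r, hr, htr⟩ := transfer c.hK.le c.hf (hI n).der hder (hlLf n) (hinc n)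
    (κ := min ε (σ / 2)) (by positivity)
  obtain ⟨r', hr', hc⟩ := Metric.continuous_iff.1 c.hπ xt r hr
  refine ⟨ball xt (min r' (δ n)), isOpen_ball, mem_ball_self (lt_min hr' (hδ n)), ?_⟩
  intro x' e' L' hx' he' hd' hLL hinc'
  by_contra hcon
  rw [not_lt] at hcon
  have hx'' := mem_ball.1 hx'
  have hB : IncBd f (π x') (π xt) et (Ω (L' - Lf)) := by
    intro t
    have b1 := hinc' t
    have hetn : ‖et‖ ≤ 1 := hNet ▸ hNge et
    have b2 := c.hf (π x' + t • et) (π x')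
    have b3 := c.hf (π xt + t • et) (π xt)
    rw [add_sub_cancel_left, norm_smul, Real.norm_eq_abs] at b2 b3
    have hK := c.hK
    have b4 : K * (|t| * ‖et‖) ≤ K * (|t| * 1) := by gcongr
    have b5 : |(f (π x' + t • et) - f (π x')) - (f (π xt + t • et) - f (π xt))|
        ≤ 2 * K * |t| := by
      refine (abs_sub _ _).trans ?_
      linarith
    have b6 := hΘ (L' - Lf) (by linarith)
    have b7 := mul_le_mul_of_nonneg_right b6 (abs_nonneg t)
    refine le_trans ?_ b7
    rcases min_choice (Θ (L' - Lf)) (2 * K) with h | h <;> rw [h] <;> assumption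
  have k1 := min_le_left ε (σ / 2)
  have k2 := min_le_right ε (σ / 2)
  have hfin : IncBd f (π x') (π (s n).x) (s n).e (σ + Ω (L' - (s n).l)) := by
    refine htr (π x') ?_ _ hB _ ?_ ?_
    · rw [← dist_eq_norm]
      exact hc x' (hx''.trans_le (min_le_left _ _))
    · have := c.hΩ (L' - Lf) (Lf - (s n).l) (by linarith) (sub_nonneg.2 (hlLf n))
      rw [show L' - Lf + (Lf - (s n).l) = L' - (s n).l by ring] at this
      linarith
    · have := c.hΩ (Lf - (s n).l) (L' - Lf) (sub_nonneg.2 (hlLf n)) (by linarith)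
      rw [show Lf - (s n).l + (L' - Lf) = L' - (s n).l by ring] at this
      linarith
  have hA : (s n).adm x' L' := by
    refine hop n x' L' ?_ ((hlLf n).trans hLL.le) hfin
    have := dist_triangle x' xt (s n).x
    have := hxtd n
    have := hx''.trans_le (min_le_right r' (δ n))
    linarith
  have hpe : (s n).p e' ≤ 1 := he' ▸ hpN n e'
  have h1 := (hI n).mx x' e' L' hA hpe hd'
  have h2 : 0 ≤ (s n).l + nu G ρ n := by
    have := c.l0_pos; have := (hI n).low; have := nu_pos c n
    linarith
  have h3 := mul_le_mul_of_nonneg_left hpe h2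
  have := hlLf n
  linarith

end ctx
end helpers

/-- Existence of a pair with almost locally maximal directional derivative. -/
theorem statement4 {M Y : Type*} [MetricSpace M] [CompleteSpace M] [Nonempty M]
    [NormedAddCommGroup Y] [NormedSpace ℝ Y] [CompleteSpace Y]
    (π : M → Y) (hπ : Continuous π)
    (Θ : ℝ → ℝ) (hΘpos : ∀ t > (0:ℝ), 0 < Θ t)
    (hΘ0 : Tendsto Θ (nhdsWithin 0 (Ioi 0)) (nhds 0))
    (g : Y → ℝ) (Lg : NNReal) (hg : LipschitzWith Lg g)
    (hgmin : ∀ K : NNReal, LipschitzWith K g → Lg ≤ K)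
    (x₀ : M) (e₀ : Y) (L₀ : ℝ) (he₀ : ‖e₀‖ = 1)
    (hd₀ : HasDirDeriv g (π x₀) e₀ L₀) (hL₀ : 0 ≤ L₀) :
    -- (1) a functional `e₀* ∈ Y*` with `‖e₀*‖ = e₀*(e₀) = 1`, determining
    -- the Lipschitz function `f = g + 2 Lip(g) e₀*`,
    ∃ e₀star : Y →L[ℝ] ℝ, ‖e₀star‖ = 1 ∧ e₀star e₀ = 1 ∧
    ∃ f : Y → ℝ, f = (fun v : Y => g v + 2 * (Lg : ℝ) * e₀star v) ∧
    -- (2) a norm `‖·‖'` on `Y` with `‖y‖ ≤ ‖y‖' ≤ 2‖y‖`,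
    ∃ N : Y → ℝ,
      (∀ u v : Y, N (u + v) ≤ N u + N v) ∧
      (∀ (a : ℝ) (u : Y), N (a • u) = |a| * N u) ∧
      (∀ u : Y, N u = 0 → u = 0) ∧
      (∀ u : Y, ‖u‖ ≤ N u ∧ N u ≤ 2 * ‖u‖) ∧
      -- moreover, if `‖·‖` is Fréchet differentiable away from `0` then so is `‖·‖'`
      ((∀ u : Y, u ≠ 0 → DifferentiableAt ℝ (fun v : Y => ‖v‖) u) →
        ∀ u : Y, u ≠ 0 → DifferentiableAt ℝ N u) ∧
      -- (3) a pair `(x̃,ẽ) ∈ D` with `‖ẽ‖' = 1` whose directional derivative is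
      -- almost locally maximal
      ∃ (xt : M) (et : Y) (Lf : ℝ),
        N et = 1 ∧
        HasDirDeriv f (π xt) et Lf ∧
        L₀ + 2 * (Lg : ℝ) * e₀star e₀ ≤ Lf ∧
        ∀ ε > (0:ℝ), ∃ Nε : Set M, IsOpen Nε ∧ xt ∈ Nε ∧
          ∀ (x' : M) (e' : Y) (L' : ℝ), x' ∈ Nε → N e' = 1 →
            HasDirDeriv f (π x') e' L' → Lf < L' →
            (∀ t : ℝ, |(f (π x' + t • et) - f (π x')) -
                (f (π xt + t • et) - f (π xt))| ≤ Θ (L' - Lf) * |t|) →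
            L' < Lf + ε := by
  obtain ⟨φ, hφ1, hφe⟩ := exists_dual_vector ℝ e₀ (by rw [he₀]; norm_num)
  have hφe₀ : φ e₀ = 1 := by simpa [he₀] using hφe
  have hφle : ∀ u, |φ u| ≤ ‖u‖ := fun u => by
    have := φ.le_opNorm u
    rwa [hφ1, one_mul, Real.norm_eq_abs] at this
  have hgl : ∀ u v, |g u - g v| ≤ (Lg : ℝ) * ‖u - v‖ := fun u v => by
    have := hg.dist_le_mul u v
    rwa [Real.dist_eq, dist_eq_norm] at this
  have hLg0 : (0:ℝ) ≤ Lg := Lg.coe_nonneg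
  refine ⟨φ, hφ1, hφe₀, _, rfl, ?_⟩
  set f : Y → ℝ := fun v : Y => g v + 2 * (Lg : ℝ) * φ v with hfdef
  have hf : ∀ u v, |f u - f v| ≤ (3 * Lg : ℝ) * ‖u - v‖ := fun u v => by
    have h1 := hgl u v
    have h2 := hφle (u - v)
    rw [map_sub] at h2
    have h3 : f u - f v = (g u - g v) + 2 * Lg * (φ u - φ v) := by simp only [hfdef]; ring
    rw [h3]
    refine (abs_add_le _ _).trans ?_
    rw [abs_mul, abs_of_nonneg (by positivity : (0:ℝ) ≤ 2 * Lg)]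
    nlinarith
  have hquot : ∀ (y e : Y) (t : ℝ), t ≠ 0 →
      (f (y + t • e) - f y) / t = (g (y + t • e) - g y) / t + 2 * Lg * φ e := by
    intro y e t ht
    simp only [hfdef, map_add, map_smul, smul_eq_mul]
    field_simp
    ring
  have hdf₀ : HasDirDeriv f (π x₀) e₀ (L₀ + 2 * Lg * φ e₀) := by
    have h1 := Tendsto.add_const (2 * (Lg:ℝ) * φ e₀) hd₀
    refine h1.congr' ?_
    filter_upwards [eventually_mem_nhdsWithin] with t ht
    exact (hquot _ _ t ht).symm
  rcases eq_or_lt_of_le hLg0 with h0 | hpos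
  · refine ⟨fun u => ‖u‖, norm_add_le, fun a u => by simp only [norm_smul, Real.norm_eq_abs],
      fun u hu => norm_eq_zero.1 hu, fun u => ⟨le_rfl, by linarith [norm_nonneg u]⟩, fun h => h,
      x₀, e₀, _, he₀, hdf₀, le_rfl, fun ε hε => ⟨univ, isOpen_univ, mem_univ _, ?_⟩⟩
    intro x' e' L' _ _ hd' hlt _
    exfalso
    have := hd'.le_lip hf
    rw [← h0] at this hlt
    linarith
  · obtain ⟨Ω, hΩ, hΩ0, hΘΩ, hΩt⟩ := exists_Omega Θ hΘpos hΘ0 (2 * (3 * Lg)) (by positivity)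
    have c : Ctx π f φ Ω (Lg : ℝ) (3 * Lg) (1 / (16 * (3 * Lg + 1))) (L₀ + 2 * Lg * φ e₀) := by
      refine ⟨hπ, hpos, by positivity, by positivity, ?_, ?_, ?_, hφle, hf, ?_, hΩ, hΩ0⟩
      · rw [div_le_one (by positivity)]; linarith
      · rw [mul_one_div, mul_div, div_le_one (by positivity)]; linarith
      · rw [hφe₀]; linarith
      · intro y e L h
        refine h.le_of fun t ht => ?_
        rw [hquot y e t ht]
        have h1 := hgl (y + t • e) y
        rw [add_sub_cancel_left, norm_smul, Real.norm_eq_abs] at h1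
        have h2 : (g (y + t • e) - g y) / t ≤ Lg * ‖e‖ := by
          refine (le_abs_self _).trans ?_
          rw [abs_div, div_le_iff₀ (abs_pos.2 ht)]
          linarith
        linarith
    exact core c x₀ e₀ he₀ hdf₀ Θ hΘΩ hΩt
end

section
/- Let (Y,‖·‖) be a Banach space, f : Y → ℝ Lipschitz with Lip(f) > 0, and ε ∈ (0, Lip(f)/9). Suppose y ∈ Y, e ∈ Y with ‖e‖ = 1, and s > 0 are such that the directional derivative f'(y,e) exists, is non-negative, and |f(y+te) − f(y) − f'(y,e)t| ≤ (ε²/(160·Lip(f)))·|t| for all |t| ≤ s·√(2·Lip(f)/ε). Suppose further ξ ∈ (−s/2, s/2) and λ ∈ Y satisfy |f(y+λ) − f(y+ξe)| ≥ 240εs, ‖λ − ξe‖ ≤ s·√(ε/Lip(f)), and ‖πse + λ‖/|πs + ξ| ≤ 1 + ε/(4·Lip(f)) for π = ±1. Then whenever s₁, s₂, λ' ∈ Y satisfy max(‖s₁ − se‖, ‖s₂ − se‖) ≤ (ε²/(320·Lip(f)²))·s and ‖λ' − λ‖ ≤ εs/(16·Lip(f)), there exist y' ∈ [y−s₁, y+λ']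 ∪ [y+λ', y+s₂] and e' ∈ Y with ‖e'‖ = 1 such that the directional derivative f'(y',e') exists, f'(y',e') ≥ f'(y,e) + ε, and for all t ∈ ℝ: |(f(y'+te) − f(y')) − (f(y+te) − f(y))| ≤ 25·√((f'(y',e') − f'(y,e))·Lip(f))·|t|. -/
open Metric Set Filter

open MeasureTheory Topology

lemma mono_of_ae {W : ℝ → ℝ} {C : NNReal} (hW : LipschitzWith C W) {a b : ℝ} (hab : a ≤ b)
    (h : ∀ᵐ x, x ∈ Ioo a b → ∃ v, HasDerivAt W v x ∧ 0 ≤ v) : W a ≤ W b := by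
  have hac : AbsolutelyContinuousOnInterval W a b :=
    (hW.lipschitzOnWith (s := uIcc a b)).absolutelyContinuousOnInterval
  have h1 := hac.integral_deriv_eq_sub
  have h2 : 0 ≤ ∫ x in a..b, deriv W x := by
    apply intervalIntegral.integral_nonneg_of_ae_restrict hab
    rw [EventuallyLE, ae_restrict_iff' measurableSet_Icc]
    have ha : ∀ᵐ x : ℝ, x ≠ a := by simp [ae_iff]
    have hb : ∀ᵐ x : ℝ, x ≠ b := by simp [ae_iff]
    filter_upwards [h, ha, hb] with x hx hxa hxb hxI
    obtain ⟨v, hv, hv0⟩ := hx ⟨lt_of_le_of_ne hxI.1 (Ne.symm hxa), lt_of_le_of_ne hxI.2 hxb⟩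
    simpa [hv.deriv] using hv0
  linarith

/-- rising sun -/
lemma rising_sun {F : ℝ → ℝ} {C : NNReal} (hF : LipschitzWith C F) {B : ℝ} (hB : ∀ x, F x ≤ B)
    {q : ℝ} (hq : ∀ x, q ≤ x → F x = F q) {l : ℝ} (hl : 0 ≤ l) :
    ∃ D : ℝ → ℝ, (∃ C' : NNReal, LipschitzWith C' D) ∧ (∀ x, 0 ≤ D x) ∧ D q = 0 ∧
      ∀ τ u v, HasDerivAt F u τ → HasDerivAt D v τ → (v = 0 ∨ v = l - u) ∧
        ((∃ t > 0, l * t < F (τ + t) - F τ) → v = l - u) := by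
  set P : ℝ → ℝ := fun x => ⨆ t : NNReal, (F (x + t) - l * t) with hP
  have hbdd : ∀ x, BddAbove (range fun t : NNReal => (F (x + t) - l * t)) := by
    intro x
    refine ⟨B, ?_⟩
    rintro _ ⟨t, rfl⟩
    have := hB (x + t)
    have : 0 ≤ l * t := by positivity
    simp only
    linarith
  have hle : ∀ x t : ℝ, 0 ≤ t → F (x + t) - l * t ≤ P x := by
    intro x t ht
    exact le_ciSup (hbdd x) ⟨t, ht⟩
  have hge : ∀ x, F x ≤ P x := by
    intro x
    simpa using hle x 0 le_rfl
  have hPlip : LipschitzWith C P := by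
    apply LipschitzWith.of_le_add_mul
    intro x z
    apply ciSup_le
    intro t
    have h1 := hle z t t.2
    have h2 := hF.dist_le_mul (x + t) (z + t)
    rw [dist_add_right, Real.dist_eq] at h2
    have h3 := (abs_le.1 h2).2
    linarith
  refine ⟨fun x => P x - F x, ⟨_, hPlip.sub hF⟩, fun x => sub_nonneg.2 (hge x), ?_, ?_⟩
  · have : P q ≤ F q := by
      apply ciSup_le
      intro t
      rw [hq (q + t) (by have := t.2; simp)]
      have : 0 ≤ l * t := by positivity
      linarith
    have := hge q
    simp only
    linarith
  · intro τ u v hu hv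
    have hPd : HasDerivAt P (v + u) τ := by
      have := hv.add hu
      refine this.congr_of_eventuallyEq (Eventually.of_forall fun x => ?_)
      simp
    have key : F τ < P τ → v = l - u := by
      intro hlt
      -- P x - l x constant to the right of τ
      have hcont : ContinuousAt (fun x => F x - l * (x - τ)) τ := by
        have := hF.continuous
        fun_prop
      have hev : ∀ᶠ x in 𝓝 τ, F x - l * (x - τ) < (F τ + P τ) / 2 := by
        apply hcont.eventually_lt continuousAt_const
        simp; linarith
      obtain ⟨r, hr, hball⟩ := Metric.eventually_nhds_iff.1 hev
      have heq : ∀ x ∈ Ico τ (τ + r), P x = P τ + l * (x - τ) := by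
        intro x hx
        apply le_antisymm
        · apply ciSup_le
          intro t
          have := hle τ (x - τ + t) (by have := t.2; have := hx.1; linarith [NNReal.coe_nonneg t])
          rw [show τ + (x - τ + t) = x + t by ring] at this
          linarith
        · have h1 : P τ ≤ max ((F τ + P τ) / 2) (P x - l * (x - τ)) := by
            apply ciSup_le
            intro t
            by_cases htx : τ + t < x
            · apply le_max_of_le_left
              have := @hball (τ + t) (by
                rw [Real.dist_eq, show τ + (t:ℝ) - τ = t by ring, abs_of_nonneg (NNReal.coe_nonneg t)]
                linarith [hx.2])
              simp only [add_sub_cancel_left] at this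
              exact this.le
            · apply le_max_of_le_right
              have := hle x (τ + t - x) (by linarith)
              rw [show x + (τ + t - x) = τ + t by ring] at this
              linarith
          rcases le_max_iff.1 h1 with h | h
          · linarith
          · linarith
      have h1 : HasDerivWithinAt P (v + u) (Ici τ) τ := hPd.hasDerivWithinAt
      have h2 : HasDerivWithinAt P l (Ici τ) τ := by
        have h3 : HasDerivAt (fun x => P τ + l * (x - τ)) l τ := by
          simpa using (((hasDerivAt_id τ).sub_const τ).const_mul l).const_add (P τ)
        refine h3.hasDerivWithinAt.congr_of_eventuallyEq ?_ (by simp)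
        filter_upwards [Ico_mem_nhdsGE (show τ < τ + r by linarith)] with x hx using heq x hx
      have := (uniqueDiffWithinAt_Ici τ).eq_deriv _ h1 h2
      linarith
    constructor
    · rcases (hge τ).lt_or_eq with h | h
      · exact Or.inr (key h)
      · left
        have hmin : IsLocalMin (fun x => P x - F x) τ := by
          refine Eventually.of_forall fun x => ?_
          have := hge x
          simp only
          linarith
        exact hmin.hasDerivAt_eq_zero hv
    · rintro ⟨t, ht, htl⟩
      apply key
      have := hle τ t ht.le
      linarith

lemma sum_est0 {δ u : ℝ} (hδ : 0 < δ) (hu : 0 ≤ u) (n : ℕ)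
    (d : ℕ → ℝ) (h0 : ∀ k ∈ Finset.Icc 1 n, 0 ≤ d k ∨ k * δ - u ≤ d k) :
    - (u ^ 2 / δ) ≤ ∑ k ∈ Finset.Icc 1 n, d k := by
  have h2 : ∀ k ∈ Finset.Icc 1 n, (if k * δ < u then -u else 0) ≤ d k := by
    intro k hk
    have : 0 ≤ k * δ := by positivity
    rcases h0 k hk with h | h <;> split_ifs <;> linarith
  refine le_trans ?_ (Finset.sum_le_sum h2)
  rw [← Finset.sum_filter, Finset.sum_const, nsmul_eq_mul]
  have hc : (Finset.filter (fun k : ℕ => k * δ < u) (Finset.Icc 1 n)).card ≤ ⌊u / δ⌋₊ := by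
    calc _ ≤ (Finset.Icc 1 ⌊u / δ⌋₊).card := by
          apply Finset.card_le_card
          intro k hk
          simp only [Finset.mem_filter, Finset.mem_Icc] at hk ⊢
          exact ⟨hk.1.1, Nat.le_floor (by rw [le_div_iff₀ hδ]; exact hk.2.le)⟩
      _ = _ := by simp
  have hc2 : ((Finset.filter (fun k : ℕ => k * δ < u) (Finset.Icc 1 n)).card : ℝ) ≤ u / δ :=
    le_trans (by exact_mod_cast hc) (Nat.floor_le (by positivity))
  have : u ^ 2 / δ = u / δ * u := by ring
  rw [this]
  nlinarith

lemma sum_est {δ u l : ℝ} (hδ : 0 < δ) (hu : 0 ≤ u) (hl : 4 * δ ≤ l) (hul : u ≤ l / 4) (n : ℕ)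
    (hn : l / δ ≤ n) (d : ℕ → ℝ) (h0 : ∀ k ∈ Finset.Icc 1 n, 0 ≤ d k ∨ k * δ - u ≤ d k)
    (h1 : ∀ k ∈ Finset.Icc 1 n, k * δ ≤ l → k * δ - u ≤ d k) :
    l ^ 2 / (16 * δ) - u ^ 2 / δ ≤ ∑ k ∈ Finset.Icc 1 n, d k := by
  have hl0 : 0 < l := by linarith
  -- subtract the contribution of the middle levels
  have h2 := sum_est0 hδ hu n
    (fun k => d k - if (l / 2 ≤ k * δ ∧ k * δ ≤ l) then l / 4 else 0) (by
      intro k hk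
      by_cases hc : l / 2 ≤ k * δ ∧ k * δ ≤ l
      · have := h1 k hk hc.2
        left
        simp only [hc, and_self, if_true]
        linarith [hc.1]
      · simp only [hc, if_false, sub_zero]
        exact h0 k hk)
  rw [Finset.sum_sub_distrib, ← Finset.sum_filter, Finset.sum_const, nsmul_eq_mul] at h2
  have hc : (Finset.Icc ⌈l / (2 * δ)⌉₊ ⌊l / δ⌋₊).card ≤
      (Finset.filter (fun k : ℕ => l / 2 ≤ k * δ ∧ k * δ ≤ l) (Finset.Icc 1 n)).card := by
    apply Finset.card_le_card
    intro k hk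
    simp only [Finset.mem_filter, Finset.mem_Icc] at hk ⊢
    have e1 := Nat.le_of_ceil_le hk.1
    have e2 := (Nat.le_floor_iff (by positivity)).1 hk.2
    have e3 : l / 2 ≤ k * δ := by
      rw [div_le_iff₀ (by positivity)] at e1; linarith
    have e4 : k * δ ≤ l := by rwa [le_div_iff₀ hδ] at e2
    refine ⟨⟨?_, ?_⟩, e3, e4⟩
    · rcases Nat.eq_zero_or_pos k with h | h
      · subst h; simp at e3; linarith
      · exact h
    · exact_mod_cast e2.trans hn
  rw [Nat.card_Icc] at hc
  have f1 : l / δ < ⌊l / δ⌋₊ + 1 := Nat.lt_floor_add_one _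
  have f2 : (⌈l / (2 * δ)⌉₊ : ℝ) < l / (2 * δ) + 1 := Nat.ceil_lt_add_one (by positivity)
  have f3 : l / (2 * δ) = l / δ / 2 := by field_simp
  have f4 : 4 ≤ l / δ := by rw [le_div_iff₀ hδ]; exact hl
  have hc3 : (⌊l / δ⌋₊ : ℝ) + 1 - ⌈l / (2 * δ)⌉₊ ≤
      (Finset.filter (fun k : ℕ => l / 2 ≤ k * δ ∧ k * δ ≤ l) (Finset.Icc 1 n)).card := by
    have : ⌊l / δ⌋₊ + 1 ≤
      (Finset.filter (fun k : ℕ => l / 2 ≤ k * δ ∧ k * δ ≤ l) (Finset.Icc 1 n)).card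
        + ⌈l / (2 * δ)⌉₊ := by omega
    have : ((⌊l / δ⌋₊ + 1 : ℕ) : ℝ) ≤ (((Finset.filter (fun k : ℕ => l / 2 ≤ k * δ ∧ k * δ ≤ l)
      (Finset.Icc 1 n)).card + ⌈l / (2 * δ)⌉₊ : ℕ) : ℝ) := by exact_mod_cast this
    push_cast at this
    linarith
  have hc4 : l / δ / 4 ≤
      (Finset.filter (fun k : ℕ => l / 2 ≤ k * δ ∧ k * δ ≤ l) (Finset.Icc 1 n)).card := by
    linarith
  have hc5 := mul_le_mul_of_nonneg_right hc4 (show 0 ≤ l / 4 by positivity)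
  have : l ^ 2 / (16 * δ) = l / δ / 4 * (l / 4) := by field_simp; norm_num
  rw [this]
  linarith

lemma one_sided {F : ℝ → ℝ} {C : NNReal} (hF : LipschitzWith C F) {B : ℝ} (hB : ∀ x, F x ≤ B)
    {q : ℝ} (hq : ∀ x, q ≤ x → F x = F q) {L a : ℝ} (hL : 0 < L) (hCL : C ≤ 25 * L)
    (ha : 0 < a) :
    ∃ V : ℝ → ℝ, (∃ C' : NNReal, LipschitzWith C' V) ∧ (∀ x, 0 ≤ V x) ∧ V q = 0 ∧
      ∀ᵐ τ, ∀ u, HasDerivAt F u τ → ∃ v, HasDerivAt V v τ ∧ - (u ^ 2 / (25 * L)) ≤ v ∧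
        (a ≤ |u| → (∃ t > 0, 20 * √(|u| * L) * t < F (τ + t) - F τ) →
          |u| - u ^ 2 / (25 * L) ≤ v) := by
  set δ : ℝ := 5 * √(a * L) with hδdef
  have hδ : 0 < δ := by positivity
  set n : ℕ := ⌈C / δ⌉₊ with hn
  have hex : ∀ k : ℕ, _ := fun k => rising_sun hF hB hq (l := k * δ) (by positivity)
  choose D hDlip hD0 hDq hD using hex
  choose CD hCD using hDlip
  have hdiff : ∀ᵐ τ, ∀ k, DifferentiableAt ℝ (D k) τ :=
    ae_all_iff.2 fun k => (hCD k).ae_differentiableAt_real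
  have hsum : ∀ S : Finset ℕ, ∃ C' : NNReal, LipschitzWith C' (fun x => ∑ k ∈ S, D k x) := by
    intro S
    induction S using Finset.induction_on with
    | empty => exact ⟨0, by simp⟩
    | insert k S hk ih =>
      obtain ⟨C', hC'⟩ := ih
      refine ⟨CD k + C', ?_⟩
      simp_rw [Finset.sum_insert hk]
      exact (hCD k).add hC'
  obtain ⟨C', hC'⟩ := hsum (Finset.Icc 1 n)
  have hw : 0 ≤ δ / (25 * L) := by positivity
  refine ⟨fun x => δ / (25 * L) * ∑ k ∈ Finset.Icc 1 n, D k x,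
    ⟨‖δ / (25 * L)‖₊ * C', ?_⟩, ?_, ?_, ?_⟩
  · exact (lipschitzWith_smul (δ / (25 * L))).comp hC'
  · intro x
    exact mul_nonneg hw (Finset.sum_nonneg fun k _ => hD0 k x)
  · simp [hDq]
  · filter_upwards [hdiff] with τ hτ u hu
    refine ⟨δ / (25 * L) * ∑ k ∈ Finset.Icc 1 n, deriv (D k) τ, ?_, ?_, ?_⟩
    · exact (HasDerivAt.fun_sum fun k _ => (hτ k).hasDerivAt).const_mul _
    · have h := sum_est0 hδ (abs_nonneg u) n (fun k => deriv (D k) τ) (by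
        intro k _
        rcases (hD k τ u _ hu (hτ k).hasDerivAt).1 with h | h
        · left; exact h.ge
        · right; rw [h]; linarith [le_abs_self u])
      have := mul_le_mul_of_nonneg_left h hw
      refine le_trans (le_of_eq ?_) this
      rw [sq_abs]
      field_simp
    · rintro hau ⟨t, ht, htF⟩
      set l := 20 * √(|u| * L) with hl
      have hu0 : 0 < |u| := by linarith
      have huC : |u| ≤ C := by
        have := hu.le_of_lipschitz hF
        simpa using this
      have hlC : l ≤ C := by
        have := hF.dist_le_mul (τ + t) τ
        rw [Real.dist_eq, Real.dist_eq, show τ + t - τ = t by ring, abs_of_pos ht] at this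
        have := (abs_le.1 this).2
        by_contra hh
        push Not at hh
        nlinarith
      have h := sum_est hδ hu0.le (l := l) (by
          rw [hδdef, hl]
          have : √(a * L) ≤ √(|u| * L) := Real.sqrt_le_sqrt (by gcongr)
          linarith) (by
          rw [hl]
          have : |u| / 5 ≤ √(|u| * L) := by
            apply Real.le_sqrt_of_sq_le
            nlinarith
          linarith) n (by
          refine le_trans ?_ (Nat.le_ceil _)
          gcongr) (fun k => deriv (D k) τ) (by
        intro k _
        rcases (hD k τ u _ hu (hτ k).hasDerivAt).1 with h | h
        · left; exact h.ge
        · right; rw [h]; linarith [le_abs_self u]) (by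
        intro k _ hk
        have := (hD k τ u _ hu (hτ k).hasDerivAt).2 ⟨t, ht, lt_of_le_of_lt (by gcongr) htF⟩
        rw [this]; linarith [le_abs_self u])
      have := mul_le_mul_of_nonneg_left h hw
      refine le_trans (le_of_eq ?_) this
      rw [sq_abs, hl, mul_pow, Real.sq_sqrt (by positivity)]
      field_simp
      ring

lemma two_sided {F : ℝ → ℝ} {C : NNReal} (hF : LipschitzWith C F) {B : ℝ} (hB : ∀ x, |F x| ≤ B)
    {p q : ℝ} (hp : ∀ x, x ≤ p → F x = F p) (hq : ∀ x, q ≤ x → F x = F q)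
    {L a : ℝ} (hL : 0 < L) (hCL : C ≤ 25 * L) (ha : 0 < a) :
    ∃ V : ℝ → ℝ, (∃ C' : NNReal, LipschitzWith C' V) ∧ V q ≤ V p ∧
      ∀ᵐ τ, ∀ u, HasDerivAt F u τ → ∃ v, HasDerivAt V v τ ∧ - (4 * (u ^ 2 / (25 * L))) ≤ v ∧
        (a ≤ |u| → (∃ t, 20 * √(|u| * L) * |t| < |F (τ + t) - F τ|) →
          |u| - 4 * (u ^ 2 / (25 * L)) ≤ v) := by
  have hneg : LipschitzWith C (fun x => - F x) := by
    have := hF.neg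
    exact this
  have hrefl : LipschitzWith C (fun x => F (-x)) := by
    have h1 : LipschitzWith 1 (fun x : ℝ => -x) := LipschitzWith.id.neg
    have := hF.comp h1
    simpa [Function.comp_def] using this
  have hnegrefl : LipschitzWith C (fun x => - F (-x)) := by
    have := hrefl.neg
    exact this
  obtain ⟨V1, ⟨C1, hC1⟩, h10, h1q, h1⟩ := one_sided hF (fun x => (abs_le.1 (hB x)).2) hq hL hCL ha
  obtain ⟨V2, ⟨C2, hC2⟩, h20, h2q, h2⟩ := one_sided hneg (B := B)
    (fun x => by linarith [(abs_le.1 (hB x)).1]) (q := q) (fun x hx => by rw [hq x hx]) hL hCL ha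
  obtain ⟨V3, ⟨C3, hC3⟩, h30, h3q, h3⟩ := one_sided hrefl (fun x => (abs_le.1 (hB (-x))).2)
    (q := -p) (fun x hx => by rw [hp (-x) (by linarith), neg_neg]) hL hCL ha
  obtain ⟨V4, ⟨C4, hC4⟩, h40, h4q, h4⟩ := one_sided hnegrefl (B := B)
    (fun x => by linarith [(abs_le.1 (hB (-x))).1])
    (q := -p) (fun x hx => by rw [hp (-x) (by linarith), neg_neg]) hL hCL ha
  have hqm := (quasiMeasurePreserving_neg (volume : Measure ℝ))
  have h3' := hqm.ae h3
  have h4' := hqm.ae h4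
  have hnlip : LipschitzWith 1 (fun x : ℝ => -x) := LipschitzWith.id.neg
  refine ⟨fun x => V1 x + V2 x - V3 (-x) - V4 (-x), ⟨C1 + C2 + C3 * 1 + C4 * 1,
    ((hC1.add hC2).sub (hC3.comp hnlip)).sub (hC4.comp hnlip)⟩, ?_, ?_⟩
  · simp only [h1q, h2q, h3q, h4q]
    linarith [h10 p, h20 p, h30 (-q), h40 (-q)]
  · filter_upwards [h1, h2, h3', h4'] with τ k1 k2 k3 k4 u hu
    have hur : HasDerivAt (fun x => F (-x)) (-u) (-τ) := by
      have := HasDerivAt.comp (-τ) (h₂ := F) (h := fun x => -x) (h₂' := u) (by simpa using hu)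
        (hasDerivAt_neg (-τ))
      simpa [Function.comp_def] using this
    obtain ⟨v1, hv1, b1, c1⟩ := k1 u hu
    obtain ⟨v2, hv2, b2, c2⟩ := k2 (-u) hu.fun_neg
    obtain ⟨v3, hv3, b3, c3⟩ := k3 (-u) hur
    obtain ⟨v4, hv4, b4, c4⟩ := k4 u (by simpa using hur.fun_neg)
    have hr : ∀ {V : ℝ → ℝ} {v : ℝ}, HasDerivAt V v (-τ) →
        HasDerivAt (fun x => V (-x)) (-v) τ := by
      intro V v hv
      have := HasDerivAt.comp τ (h₂ := V) (h := fun x => -x) (h₂' := v) hv (hasDerivAt_neg τ)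
      simpa [Function.comp_def] using this
    refine ⟨v1 + v2 - -v3 - -v4, ((hv1.add hv2).sub (hr hv3)).sub (hr hv4), ?_, ?_⟩
    · simp only [neg_sq] at b2 b3
      linarith
    · rintro hau ⟨t, ht⟩
      simp only [neg_sq, abs_neg, neg_neg] at b2 b3 b4 c2 c3 c4
      rcases lt_trichotomy t 0 with h0 | h0 | h0
      · rw [abs_of_neg h0] at ht
        rcases lt_abs.1 ht with h | h
        · have := c3 hau ⟨-t, by linarith, by
            rw [show -(-τ + -t) = τ + t by ring]; exact h⟩
          linarith
        · have := c4 hau ⟨-t, by linarith, by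
            rw [show -(-τ + -t) = τ + t by ring]; linarith⟩
          linarith
      · subst h0
        simp at ht
      · rw [abs_of_pos h0] at ht
        rcases lt_abs.1 ht with h | h
        · have := c1 hau ⟨t, h0, h⟩
          linarith
        · have := c2 hau ⟨t, h0, by linarith⟩
          linarith

lemma oneD {F : ℝ → ℝ} {C : NNReal} (hF : LipschitzWith C F) {B : ℝ} (hB : ∀ x, |F x| ≤ B)
    {p q : ℝ} (hp : ∀ x, x ≤ p → F x = F p) (hq : ∀ x, q ≤ x → F x = F q)
    {L a η ξ : ℝ} (hL : 0 < L) (hCL : C ≤ 2.1 * L) (ha : 0 < a) (hη : 0 ≤ η)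
    (hξp : p + η ≤ ξ) (hξq : ξ ≤ q - η)
    (hmain : a * (q - p) + 4.2 * L * η < 0.32 * (F ξ - F p) + 0.34 * (F q - F p) ∨
      a * (q - p) + 4.2 * L * η < 0.32 * (F q - F ξ) + 0.34 * (F q - F p)) :
    ∃ τ ∈ Ioo (p + η) (q - η), τ ≠ ξ ∧ ∃ u, HasDerivAt F u τ ∧ a ≤ u ∧
      ∀ t, |F (τ + t) - F τ| ≤ 20 * √(u * L) * |t| := by
  by_contra hcon
  push Not at hcon
  obtain ⟨V, ⟨CV, hCV⟩, hVpq, hV⟩ := two_sided hF hB hp hq hL (by linarith) ha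
  have hsq : ∀ u : ℝ, |u| ≤ 2.1 * L → 4 * (u ^ 2 / (25 * L)) ≤ 0.34 * |u| := by
    intro u hu
    rw [← sq_abs, ← mul_div_assoc, div_le_iff₀ (by positivity)]
    nlinarith [abs_nonneg u]
  have hdiff := hF.ae_differentiableAt_real
  have hξne : ∀ᵐ x : ℝ, x ≠ ξ := by simp [ae_iff]
  have hsub : ∀ (b c : ℝ), LipschitzWith (CV + (‖b‖₊ * C + ‖c‖₊))
      (fun x => V x - (b * F x - c * x)) := by
    intro b c
    refine hCV.sub (LipschitzWith.sub ?_ ?_)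
    · exact (lipschitzWith_smul b).comp hF
    · exact lipschitzWith_smul c
  have gen : ∀ x1 x2 b c : ℝ, x1 ≤ x2 →
      (∀ᵐ τ, τ ∈ Ioo x1 x2 → ∀ u v, HasDerivAt F u τ → HasDerivAt V v τ → |u| ≤ 2.1 * L →
        -(0.34 * |u|) ≤ v → (a ≤ u → p + η < τ → τ < q - η → u - 0.34 * u ≤ v) →
         b * u - c ≤ v) →
      b * (F x2 - F x1) - c * (x2 - x1) ≤ V x2 - V x1 := by
    intro x1 x2 b c h12 h
    have := mono_of_ae (hsub b c) h12 (by
      filter_upwards [h, hV, hdiff, hξne] with τ k1 k2 k3 k4 hτ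
      obtain ⟨v, hv, e1, e2⟩ := k2 _ k3.hasDerivAt
      refine ⟨v - (b * deriv F τ - c * 1), hv.sub ((k3.hasDerivAt.const_mul b).sub
        ((hasDerivAt_id τ).const_mul c)), ?_⟩
      have hu : |deriv F τ| ≤ 2.1 * L := by
        refine le_trans ?_ hCL
        simpa using k3.hasDerivAt.le_of_lipschitz hF
      have := k1 hτ _ _ k3.hasDerivAt hv hu (by linarith [hsq _ hu]) (by
        intro hau h1 h2
        obtain ⟨t, ht⟩ := hcon τ ⟨h1, h2⟩ k4 _ k3.hasDerivAt hau
        have habs : |deriv F τ| = deriv F τ := abs_of_nonneg (by linarith)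
        have := e2 (by rwa [habs]) ⟨t, by rwa [habs]⟩
        have := hsq _ hu
        rw [habs] at *
        linarith)
      linarith)
    linarith
  have mid : ∀ x1 x2 b : ℝ, (b = 0.34 ∨ b = 0.66) → x1 ≤ x2 → p + η ≤ x1 → x2 ≤ q - η →
      b * (F x2 - F x1) - a * (x2 - x1) ≤ V x2 - V x1 := by
    intro x1 x2 b hb h12 hx1 hx2
    apply gen _ _ _ _ h12
    refine Eventually.of_forall ?_
    intro τ hτ u v _ _ hu h1 h2
    by_cases hau : a ≤ u
    · have := h2 hau (by linarith [hτ.1]) (by linarith [hτ.2])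
      rcases hb with rfl | rfl <;> linarith
    · push Not at hau
      rcases le_total 0 u with h0 | h0
      · rw [abs_of_nonneg h0] at h1
        rcases hb with rfl | rfl <;> linarith
      · rw [abs_of_nonpos h0] at h1
        rcases hb with rfl | rfl <;> linarith
  have edge : ∀ x1 x2 b : ℝ, (b = 0.34 ∨ b = 0.66) → x1 ≤ x2 →
      b * (F x2 - F x1) - (a + 2.1 * L) * (x2 - x1) ≤ V x2 - V x1 := by
    intro x1 x2 b hb h12
    apply gen _ _ _ _ h12
    refine Eventually.of_forall ?_
    intro τ hτ u v _ _ hu h1 h2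
    rcases le_total 0 u with h0 | h0
    · rw [abs_of_nonneg h0] at h1 hu
      rcases hb with rfl | rfl <;> linarith
    · rw [abs_of_nonpos h0] at h1 hu
      rcases hb with rfl | rfl <;> linarith
  rcases hmain with h | h
  · have e1 := edge p (p + η) 0.66 (Or.inr rfl) (by linarith)
    have e2 := mid (p + η) ξ 0.66 (Or.inr rfl) hξp le_rfl hξq
    have e3 := mid ξ (q - η) 0.34 (Or.inl rfl) hξq hξp le_rfl
    have e4 := edge (q - η) q 0.34 (Or.inl rfl) (by linarith)
    linarith
  · have e1 := edge p (p + η) 0.34 (Or.inl rfl) (by linarith)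
    have e2 := mid (p + η) ξ 0.34 (Or.inl rfl) hξp le_rfl hξq
    have e3 := mid ξ (q - η) 0.66 (Or.inr rfl) hξq hξp le_rfl
    have e4 := edge (q - η) q 0.66 (Or.inr rfl) (by linarith)
    linarith

section Core
variable {Y : Type*} [NormedAddCommGroup Y] [NormedSpace ℝ Y]

lemma dir_deriv_scale {f : Y → ℝ} {y' v : Y} {w : ℝ} (hv : v ≠ 0)
    (h : HasDerivAt (fun t : ℝ => f (y' + t • v)) w 0) :
    HasDirDeriv f y' ((‖v‖⁻¹) • v) (w / ‖v‖) := by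
  have hnv : 0 < ‖v‖ := norm_pos_iff.2 hv
  have h2 : HasDerivAt (fun t : ℝ => f (y' + t • ((‖v‖⁻¹) • v))) (w / ‖v‖) 0 := by
    have h3 : HasDerivAt (fun t : ℝ => t * ‖v‖⁻¹) (‖v‖⁻¹) 0 := by
      simpa using (hasDerivAt_id (0:ℝ)).mul_const (‖v‖⁻¹)
    have h4 := HasDerivAt.comp (0:ℝ) (h₂ := fun t : ℝ => f (y' + t • v))
      (h := fun t : ℝ => t * ‖v‖⁻¹) (h₂' := w) (by simpa using h) h3
    simpa [Function.comp_def, mul_smul, div_eq_mul_inv] using h4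
  rw [hasDerivAt_iff_tendsto_slope_zero] at h2
  unfold HasDirDeriv
  simpa [div_eq_inv_mul] using h2

lemma path_diff (v1 v2 b : Y) (ξ x z : ℝ) : ∃ m1 m2 : ℝ, |m1| + |m2| = |x - z| ∧ m1 + m2 = x - z ∧
    (b + (min (x - ξ) 0) • v1 + (max (x - ξ) 0) • v2) -
      (b + (min (z - ξ) 0) • v1 + (max (z - ξ) 0) • v2) = m1 • v1 + m2 • v2 := by
  refine ⟨min (x - ξ) 0 - min (z - ξ) 0, max (x - ξ) 0 - max (z - ξ) 0, ?_, ?_, ?_⟩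
  · rcases le_total x ξ with h1 | h1 <;> rcases le_total z ξ with h2 | h2
    · rw [min_eq_left (by linarith), min_eq_left (by linarith), max_eq_right (by linarith),
        max_eq_right (by linarith)]
      simp
    · rw [min_eq_left (by linarith), min_eq_right (by linarith), max_eq_right (by linarith),
        max_eq_left (by linarith)]
      rw [abs_of_nonpos (by linarith), abs_of_nonpos (by linarith), abs_of_nonpos (by linarith)]
      ring
    · rw [min_eq_right (by linarith), min_eq_left (by linarith), max_eq_left (by linarith),
        max_eq_right (by linarith)]
      rw [abs_of_nonneg (by linarith), abs_of_nonneg (by linarith), abs_of_nonneg (by linarith)]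
      ring
    · rw [min_eq_right (by linarith), min_eq_right (by linarith), max_eq_left (by linarith),
        max_eq_left (by linarith)]
      simp
  · linarith [min_add_max (x - ξ) 0, min_add_max (z - ξ) 0]
  · module

lemma final_est {f : Y → ℝ} {L : ℝ} (hL : 0 < L) (hf : ∀ x z, |f x - f z| ≤ L * ‖x - z‖)
    {r s fd S τ : ℝ} (hr : 0 < r) (hr3 : r < 1 / 3) (hs : 0 < s) (hS : 0 ≤ S)
    {y e : Y} (he : ‖e‖ = 1)
    (h80 : ∀ t : ℝ, |t| ≤ 1.4 * s / r → |f (y + t • e) - f y - fd * t| ≤ L * r ^ 4 / 160 * |t|)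
    (h : ℝ → Y) (hh : ∀ x z, ‖h x - h z - (x - z) • e‖ ≤ 2.1 * r * |x - z|)
    (hend : ∀ z, z = s ∨ z = -s → ‖h z - (y + z • e)‖ ≤ r ^ 4 * s / 320)
    (hτ1 : -s + r ^ 2 * s < τ) (hτ2 : τ < s - r ^ 2 * s)
    (hF : ∀ t : ℝ, |(f (h (max (-s) (min s (τ + t)))) - fd * (max (-s) (min s (τ + t))))
      - (f (h τ) - fd * τ)| ≤ 20 * S * |t|) (t : ℝ) :
    |(f (h τ + t • e) - f (h τ)) - (f (y + t • e) - f y)| ≤ (20 * S + 5 * L * r) * |t| := by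
  have ht0 := abs_nonneg t
  have hr2 : r ^ 2 ≤ r / 3 := by nlinarith
  have hr4 : r ^ 4 ≤ r / 27 := by nlinarith [pow_pos hr 2, pow_pos hr 3]
  have hr2s : 0 < r ^ 2 * s := by positivity
  have hLr4 : L * r ^ 4 ≤ L * r / 27 := by nlinarith
  have hrange : 4.2 * s ≤ 1.4 * s / r := by
    rw [le_div_iff₀ hr]; nlinarith
  have hLrt : 0 ≤ L * r * |t| := by positivity
  by_cases hbig : 1.4 * s / r - s < |t|
  · -- large t
    have h1 := hf (h τ + t • e) (y + t • e)
    have h2 := hf (h τ) y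
    rw [add_sub_add_right_eq_sub] at h1
    have h3 : ‖h τ - y‖ ≤ 2.1 * r * (2 * s) + r ^ 4 * s / 320 + s := by
      have e1 := hh τ s
      have e2 := hend s (Or.inl rfl)
      have e3 : |τ - s| ≤ 2 * s := by rw [abs_le]; constructor <;> linarith
      have e4 : ‖τ • e‖ ≤ s := by
        rw [norm_smul, he, mul_one, Real.norm_eq_abs, abs_le]; constructor <;> linarith
      have : h τ - y = (h τ - h s - (τ - s) • e) + (h s - (y + s • e)) + τ • e := by module
      rw [this]
      refine (norm_add₃_le).trans ?_
      have : 2.1 * r * |τ - s| ≤ 2.1 * r * (2 * s) := by gcongr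
      linarith
    have h4 : ‖h τ - y‖ ≤ 2.41 * s := by nlinarith
    have h5 : 1.06 * s ≤ r * |t| := by
      have e1 : 1.4 * s / r < |t| + s := by linarith
      rw [div_lt_iff₀ hr] at e1
      nlinarith
    have h6 : L * ‖h τ - y‖ ≤ L * (2.41 * s) := by gcongr
    have h7 : L * (1.06 * s) ≤ L * (r * |t|) := by gcongr
    have h8 : 0 ≤ S * |t| := by positivity
    have g1 := abs_le.1 h1
    have g2 := abs_le.1 h2
    rw [abs_le]
    constructor <;> linarith
  push Not at hbig
  have h6 := abs_le.1 (h80 t (by linarith))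
  have h7 := abs_le.1 (hF t)
  have hLr4t : L * r ^ 4 / 160 * |t| ≤ L * r * |t| / 160 := by nlinarith
  by_cases hin : |τ + t| ≤ s
  · obtain ⟨i1, i2⟩ := abs_le.1 hin
    rw [min_eq_right i2, max_eq_right i1] at h7
    have h1 := hf (h τ + t • e) (h (τ + t))
    have h2 : ‖h τ + t • e - h (τ + t)‖ ≤ 2.1 * r * |t| := by
      have := hh (τ + t) τ
      rw [add_sub_cancel_left] at this
      rw [← norm_neg]
      refine le_trans (le_of_eq ?_) this
      congr 1
      abel
    have h3 := abs_le.1 (h1.trans (mul_le_mul_of_nonneg_left h2 hL.le))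
    rw [abs_le]
    constructor <;> nlinarith
  · push Not at hin
    obtain ⟨z, hz, hcz, hzt, hzτ⟩ : ∃ z, (z = s ∨ z = -s) ∧ max (-s) (min s (τ + t)) = z ∧
        r ^ 2 * s ≤ |t| ∧ |z - τ| ≤ |t| := by
      rcases lt_abs.1 hin with h | h
      · refine ⟨s, Or.inl rfl, ?_, ?_, ?_⟩
        · rw [min_eq_left h.le, max_eq_right (by linarith)]
        · rw [abs_of_nonneg (by linarith)]; linarith
        · rw [abs_of_nonneg (by linarith), abs_of_nonneg (by linarith)]; linarith
      · refine ⟨-s, Or.inr rfl, ?_, ?_, ?_⟩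
        · rw [min_eq_right (by linarith), max_eq_left (by linarith)]
        · rw [abs_of_nonpos (by linarith)]; linarith
        · rw [abs_of_nonpos (by linarith), abs_of_nonpos (by linarith)]; linarith
    rw [hcz] at h7
    have hzs : |z| = s := by
      rcases hz with rfl | rfl
      · exact abs_of_pos hs
      · rw [abs_neg, abs_of_pos hs]
    have hτs : |τ| ≤ s := by rw [abs_le]; constructor <;> linarith
    have hτt : |τ + t| ≤ |t| + s := (abs_add_le _ _).trans (by linarith)
    have a1 := hf (h τ + t • e) (h z + (τ + t - z) • e)
    have a1' : ‖h τ + t • e - (h z + (τ + t - z) • e)‖ ≤ 2.1 * r * |t| := by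
      have := hh z τ
      rw [← norm_neg]
      refine le_trans (le_of_eq ?_) (this.trans (by gcongr))
      congr 1
      module
    have a1 := abs_le.1 (a1.trans (mul_le_mul_of_nonneg_left a1' hL.le))
    have a2 := hf (h z + (τ + t - z) • e) (y + (τ + t) • e)
    have a2' : ‖h z + (τ + t - z) • e - (y + (τ + t) • e)‖ ≤ r ^ 4 * s / 320 := by
      refine le_trans (le_of_eq ?_) (hend z hz)
      congr 1
      module
    have a2 := abs_le.1 (a2.trans (mul_le_mul_of_nonneg_left a2' hL.le))
    have a3 := abs_le.1 ((hf (h z) (y + z • e)).trans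
      (mul_le_mul_of_nonneg_left (hend z hz) hL.le))
    have a4 := abs_le.1 ((h80 (τ + t) (by linarith)).trans
      (mul_le_mul_of_nonneg_left hτt (by positivity)))
    have a5 := abs_le.1 (h80 z (by linarith))
    rw [hzs] at a5
    have k1 : L * r ^ 4 * s ≤ L * r * |t| / 3 := by
      have : L * r ^ 4 * s = L * r ^ 2 * (r ^ 2 * s) := by ring
      rw [this]
      calc L * r ^ 2 * (r ^ 2 * s) ≤ L * (r / 3) * |t| := by gcongr
        _ = _ := by ring
    rw [abs_le]
    constructor <;> linarith
end Core

lemma fd_alg {n w L q : ℝ} (hn : 0 < n) (hL : 0 < L) (hq : 0 ≤ q) (hw : 0 ≤ w) (h1 : n ≤ 1 + q / 2)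
    (h2 : w ≤ L * n) : (w - L * q / 2) * n ≤ w := by
  have h3 : 0 ≤ L * q / 2 * n := by positivity
  rcases le_total n 1 with h | h
  · nlinarith
  · have : (n - 1) * w ≤ (q / 2) * (L * n) := by
      apply mul_le_mul _ h2 hw (by positivity)
      linarith
    linarith

section Core2
variable {Y : Type*} [NormedAddCommGroup Y] [NormedSpace ℝ Y]

set_option maxHeartbeats 1000000 in
lemma core_s12 {f : Y → ℝ} {L : ℝ} (hL : 0 < L) (hf : ∀ x z, |f x - f z| ≤ L * ‖x - z‖)
    {r s fd ξ : ℝ} (hr : 0 < r) (hr3 : r < 1 / 3) (hs : 0 < s)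
    {y e : Y} (he : ‖e‖ = 1) (hfd0 : 0 ≤ fd) (hfdL : fd ≤ L)
    (h80 : ∀ t : ℝ, |t| ≤ 1.4 * s / r → |f (y + t • e) - f y - fd * t| ≤ L * r ^ 4 / 160 * |t|)
    (hξ₁ : -(s / 2) < ξ) (hξ₂ : ξ < s / 2) {lam v1 v2 : Y}
    (hbig : 239 * (L * r ^ 2 * s) ≤ |f (y + lam) - f (y + ξ • e)|)
    (N1 : ‖v1‖ ≤ 1 + r ^ 2 / 2) (N2 : ‖v2‖ ≤ 1 + r ^ 2 / 2)
    (M1 : ‖v1 - e‖ ≤ 2.1 * r) (M2 : ‖v2 - e‖ ≤ 2.1 * r)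
    (E1 : ‖(lam - (s + ξ) • v1) - (-s) • e‖ ≤ r ^ 4 * s / 320)
    (E2 : ‖(lam + (s - ξ) • v2) - s • e‖ ≤ r ^ 4 * s / 320) :
    ∃ y' ∈ segment ℝ (y + (lam - (s + ξ) • v1)) (y + lam) ∪
        segment ℝ (y + lam) (y + (lam + (s - ξ) • v2)),
      ∃ e' : Y, ‖e'‖ = 1 ∧ ∃ fd' : ℝ, HasDirDeriv f y' e' fd' ∧
          fd + L * r ^ 2 ≤ fd' ∧
          ∀ t : ℝ, |(f (y' + t • e) - f y') - (f (y + t • e) - f y)| ≤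
            25 * Real.sqrt ((fd' - fd) * L) * |t| := by
  set h : ℝ → Y := fun x => (y + lam) + (min (x - ξ) 0) • v1 + (max (x - ξ) 0) • v2 with hdef
  have hA : ∀ x z, ‖h x - h z‖ ≤ (1 + r ^ 2 / 2) * |x - z| := by
    intro x z
    obtain ⟨m1, m2, e1, e2, e3⟩ := path_diff v1 v2 (y + lam) ξ x z
    simp only [hdef]
    rw [e3, ← e1]
    refine (norm_add_le _ _).trans ?_
    rw [norm_smul, norm_smul, Real.norm_eq_abs, Real.norm_eq_abs]
    have := mul_le_mul_of_nonneg_left N1 (abs_nonneg m1)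
    have := mul_le_mul_of_nonneg_left N2 (abs_nonneg m2)
    linarith
  have hB : ∀ x z, ‖h x - h z - (x - z) • e‖ ≤ 2.1 * r * |x - z| := by
    intro x z
    obtain ⟨m1, m2, e1, e2, e3⟩ := path_diff v1 v2 (y + lam) ξ x z
    simp only [hdef]
    rw [e3, ← e1, ← e2]
    have : m1 • v1 + m2 • v2 - (m1 + m2) • e = m1 • (v1 - e) + m2 • (v2 - e) := by module
    rw [this]
    refine (norm_add_le _ _).trans ?_
    rw [norm_smul, norm_smul, Real.norm_eq_abs, Real.norm_eq_abs]
    have := mul_le_mul_of_nonneg_left M1 (abs_nonneg m1)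
    have := mul_le_mul_of_nonneg_left M2 (abs_nonneg m2)
    linarith
  have hleft : ∀ x, x ≤ ξ → h x = (y + lam) + (x - ξ) • v1 := by
    intro x hx
    simp only [hdef]
    rw [min_eq_left (by linarith), max_eq_right (by linarith), zero_smul, add_zero]
  have hright : ∀ x, ξ ≤ x → h x = (y + lam) + (x - ξ) • v2 := by
    intro x hx
    simp only [hdef]
    rw [min_eq_right (by linarith), max_eq_left (by linarith), zero_smul, add_zero]
  have hξ : h ξ = y + lam := by rw [hleft ξ le_rfl]; simp
  have hend : ∀ z, z = s ∨ z = -s → ‖h z - (y + z • e)‖ ≤ r ^ 4 * s / 320 := by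
    rintro z (rfl | rfl)
    · rw [hright _ (by linarith)]
      refine le_trans (le_of_eq ?_) E2
      congr 1
      abel
    · rw [hleft _ (by linarith)]
      refine le_trans (le_of_eq ?_) E1
      congr 1
      module
  set c : ℝ → ℝ := fun x => max (-s) (min s x) with hc
  have hclip : ∀ x z, |c x - c z| ≤ |x - z| := by
    intro x z
    simp only [hc]
    have e1 := abs_max_sub_max_le_abs (min s x) (min s z) (-s)
    have e2 := abs_min_sub_min_le_max s x s z
    rw [sub_self, abs_zero, max_eq_right (abs_nonneg _)] at e2
    rw [max_comm (-s), max_comm (-s)]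
    exact e1.trans e2
  have hcs : ∀ x, |c x| ≤ s := by
    intro x
    rw [abs_le]
    exact ⟨le_max_left _ _, max_le (by linarith) (min_le_left _ _)⟩
  have hcin : ∀ x, -s ≤ x → x ≤ s → c x = x := by
    intro x h1 h2
    simp only [hc]
    rw [min_eq_right h2, max_eq_right h1]
  set F : ℝ → ℝ := fun x => f (h (c x)) - fd * c x with hFdef
  have hr2 : r ^ 2 ≤ 1 / 9 := by nlinarith
  have hFl : ∀ x z, |F x - F z| ≤ 2.1 * L * |x - z| := by
    intro x z
    have e1 := hf (h (c x)) (h (c z))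
    have e2 := hA (c x) (c z)
    have e3 := hclip x z
    have e4 : L * ‖h (c x) - h (c z)‖ ≤ L * ((1 + r ^ 2 / 2) * |x - z|) := by
      gcongr
      exact e2.trans (by gcongr)
    have e5 : |fd * c x - fd * c z| ≤ L * |x - z| := by
      rw [← mul_sub, abs_mul, abs_of_nonneg hfd0]
      gcongr
    have e6 : F x - F z = (f (h (c x)) - f (h (c z))) - (fd * c x - fd * c z) := by
      simp only [hFdef]; ring
    rw [e6]
    refine (abs_sub _ _).trans ?_
    have e7 : 0 ≤ L * |x - z| := by positivity
    nlinarith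
  have hFlip : LipschitzWith ⟨2.1 * L, by positivity⟩ F := by
    apply LipschitzWith.of_dist_le_mul
    intro x z
    rw [Real.dist_eq, Real.dist_eq]
    exact hFl x z
  have hFc : ∀ x, F x = F (c x) := by
    intro x
    have := abs_le.1 (hcs x)
    simp only [hFdef]
    rw [hcin (c x) this.1 this.2]
  have hFin : ∀ x, -s ≤ x → x ≤ s → F x = f (h x) - fd * x := by
    intro x h1 h2
    simp only [hFdef]
    rw [hcin x h1 h2]
  have hFb : ∀ x, |F x| ≤ |F 0| + 2.1 * L * s := by
    intro x
    have e1 := hFl (c x) 0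
    rw [sub_zero, ← hFc x] at e1
    have e2 : 2.1 * L * |c x| ≤ 2.1 * L * s := by gcongr; exact hcs x
    have e3 := abs_sub_abs_le_abs_sub (F x) (F 0)
    linarith
  have hFp : ∀ x, x ≤ -s → F x = F (-s) := by
    intro x hx
    simp only [hFdef, hc]
    rw [min_eq_right (by linarith), max_eq_left hx, min_eq_right (by linarith), max_self]
  have hFq : ∀ x, s ≤ x → F x = F s := by
    intro x hx
    simp only [hFdef, hc]
    rw [min_eq_left hx, min_self]
  -- values
  have hA0 : 0 < L * r ^ 2 * s := by positivity
  have hr4 : L * r ^ 4 * s ≤ L * r ^ 2 * s / 9 := by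
    have : L * r ^ 4 * s = L * r ^ 2 * s * r ^ 2 := by ring
    rw [this]; nlinarith
  have hrange : 4.2 * s ≤ 1.4 * s / r := by
    rw [le_div_iff₀ hr]; nlinarith
  have hFs : ∀ z, z = s ∨ z = -s → |F z - f y| ≤ L * r ^ 2 * s / 100 := by
    intro z hz
    have hzs : |z| = s := by
      rcases hz with rfl | rfl
      · exact abs_of_pos hs
      · rw [abs_neg, abs_of_pos hs]
    have := abs_le.1 hzs.le
    rw [hFin z this.1 this.2]
    have a5 := abs_le.1 (h80 z (by linarith))
    rw [hzs] at a5
    have a3 := abs_le.1 ((hf (h z) (y + z • e)).trans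
      (mul_le_mul_of_nonneg_left (hend z hz) hL.le))
    rw [abs_le]
    constructor <;> linarith
  have hF1 := abs_le.1 (hFs s (Or.inl rfl))
  have hF2 := abs_le.1 (hFs (-s) (Or.inr rfl))
  have hFξ : 238 * (L * r ^ 2 * s) ≤ |F ξ - f y| := by
    rw [hFin ξ (by linarith) (by linarith), hξ]
    have hξs : |ξ| ≤ s := by rw [abs_le]; constructor <;> linarith
    have a1 := (h80 ξ (by linarith)).trans
      (mul_le_mul_of_nonneg_left hξs (by positivity))
    have : f (y + lam) - f (y + ξ • e) = (f (y + lam) - fd * ξ - f y)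
      - (f (y + ξ • e) - f y - fd * ξ) := by ring
    rw [this] at hbig
    have := abs_sub (f (y + lam) - fd * ξ - f y) (f (y + ξ • e) - f y - fd * ξ)
    linarith
  have hr2s : r ^ 2 * s ≤ s / 9 := by nlinarith
  obtain ⟨τ, hτ, hτξ, u, hu, hau, hmax⟩ := oneD hFlip hFb hFp hFq (L := L) (a := 4 * (L * r ^ 2))
    (η := r ^ 2 * s) (ξ := ξ) hL le_rfl (by positivity) (by positivity) (by linarith)
    (by linarith) (by
      rcases le_abs.1 hFξ with hh | hh
      · left; linarith
      · right; linarith)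
  have hr2s0 : 0 < r ^ 2 * s := by positivity
  have hτ1 : -s < τ := by linarith [hτ.1]
  have hτ2 : τ < s := by linarith [hτ.2]
  have hLr2 : 0 < L * r ^ 2 := by positivity
  -- the direction
  obtain ⟨v, hvN, hvloc, hseg⟩ : ∃ v : Y, ‖v‖ ≤ 1 + r ^ 2 / 2 ∧
      (∀ᶠ x in 𝓝 τ, h x = h τ + (x - τ) • v) ∧
      h τ ∈ segment ℝ (y + (lam - (s + ξ) • v1)) (y + lam) ∪
        segment ℝ (y + lam) (y + (lam + (s - ξ) • v2)) := by
    rcases lt_or_gt_of_ne hτξ with hlt | hlt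
    · refine ⟨v1, N1, ?_, Or.inl ?_⟩
      · filter_upwards [Iio_mem_nhds hlt] with x hx
        rw [hleft x (le_of_lt hx), hleft τ hlt.le]
        module
      · have hpos : 0 < s + ξ := by linarith
        refine ⟨(ξ - τ) / (s + ξ), (s + τ) / (s + ξ), div_nonneg (by linarith) hpos.le,
          div_nonneg (by linarith) hpos.le, ?_, ?_⟩
        · field_simp; ring
        · rw [hleft τ hlt.le]
          match_scalars <;> field_simp <;> ring
    · refine ⟨v2, N2, ?_, Or.inr ?_⟩
      · filter_upwards [Ioi_mem_nhds hlt] with x hx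
        rw [hright x (le_of_lt hx), hright τ hlt.le]
        module
      · have hpos : 0 < s - ξ := by linarith
        refine ⟨(s - τ) / (s - ξ), (τ - ξ) / (s - ξ), div_nonneg (by linarith) hpos.le,
          div_nonneg (by linarith) hpos.le, ?_, ?_⟩
        · field_simp; ring
        · rw [hright τ hlt.le]
          match_scalars <;> field_simp <;> ring
  have hder : HasDerivAt (fun t : ℝ => f (h τ + t • v)) (u + fd) 0 := by
    have e1 : HasDerivAt (fun x => F x + fd * x) (u + fd) τ := by
      have := hu.fun_add ((hasDerivAt_id τ).const_mul fd)
      simpa using this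
    have e2 : HasDerivAt (fun x => f (h τ + (x - τ) • v)) (u + fd) τ := by
      refine e1.congr_of_eventuallyEq ?_
      filter_upwards [hvloc, Ioo_mem_nhds hτ1 hτ2] with x hx hx2
      rw [← hx, hFin x hx2.1.le hx2.2.le]
      ring
    have e3 := HasDerivAt.comp (0:ℝ) (h₂ := fun x => f (h τ + (x - τ) • v))
      (h := fun t : ℝ => τ + t) (h₂' := u + fd) (by simpa using e2)
      ((hasDerivAt_id (0:ℝ)).const_add τ)
    simpa [Function.comp_def] using e3
  have hnvb : u + fd ≤ L * ‖v‖ := by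
    have hlv : LipschitzWith ⟨L * ‖v‖, by positivity⟩ (fun t : ℝ => f (h τ + t • v)) := by
      apply LipschitzWith.of_dist_le_mul
      intro x z
      rw [Real.dist_eq, Real.dist_eq]
      refine (hf _ _).trans (le_of_eq ?_)
      rw [add_sub_add_left_eq_sub, ← sub_smul, norm_smul, Real.norm_eq_abs]
      change _ = L * ‖v‖ * _
      ring
    have := hder.le_of_lipschitz hlv
    rw [Real.norm_eq_abs] at this
    exact (le_abs_self _).trans this
  have hnv : 0 < ‖v‖ := by
    by_contra hcon
    have : ‖v‖ = 0 := le_antisymm (not_lt.1 hcon) (norm_nonneg _)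
    rw [this] at hnvb
    linarith
  have hfd' : fd + u - L * r ^ 2 / 2 ≤ (u + fd) / ‖v‖ := by
    rw [le_div_iff₀ hnv]
    have := fd_alg hnv hL (by positivity) (show 0 ≤ u + fd by linarith) hvN hnvb
    linarith
  refine ⟨h τ, hseg, ‖v‖⁻¹ • v, ?_, (u + fd) / ‖v‖, dir_deriv_scale (norm_pos_iff.1 hnv) hder,
    by linarith, ?_⟩
  · rw [norm_smul, norm_inv, norm_norm, inv_mul_cancel₀ hnv.ne']
  · intro t
    have hfin := final_est hL hf hr hr3 hs (Real.sqrt_nonneg (u * L)) he h80 h hB hend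
      (τ := τ) (fd := fd) (by linarith [hτ.1]) hτ.2 (by
        intro t
        have := hmax t
        rw [hFin τ hτ1.le hτ2.le] at this
        exact this) t
    refine hfin.trans ?_
    gcongr
    set T := √(((u + fd) / ‖v‖ - fd) * L) with hT
    have hw : 7 / 8 * u ≤ (u + fd) / ‖v‖ - fd := by linarith
    have hT1 : 0.935 * √(u * L) ≤ T := by
      apply Real.le_sqrt_of_sq_le
      rw [mul_pow, Real.sq_sqrt (by nlinarith)]
      nlinarith
    have hT2 : 1.8 * (L * r) ≤ T := by
      apply Real.le_sqrt_of_sq_le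
      have : (1.8 * (L * r)) ^ 2 = 3.24 * (L * r ^ 2) * L := by ring
      rw [this]
      gcongr
      linarith
    have hT0 : 0 ≤ T := Real.sqrt_nonneg _
    linarith
end Core2

set_option maxHeartbeats 2000000 in
/-- Lemma 4.1 of the paper: finding a nearby point on a wedge with a larger
directional derivative. `L` is the (smallest) Lipschitz constant of `f`, `fd = f'(y,e)` and
`fd' = f'(y',e')`. -/
theorem statement12 {Y : Type*} [NormedAddCommGroup Y] [NormedSpace ℝ Y]
    (f : Y → ℝ) (L : NNReal) (hL : LipschitzWith L f)
    (hLmin : ∀ K : NNReal, LipschitzWith K f → L ≤ K) (hLpos : 0 < (L : ℝ))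
    (ε : ℝ) (hε : 0 < ε) (hε' : ε < (L : ℝ) / 9)
    (y e : Y) (he : ‖e‖ = 1) (s : ℝ) (hs : 0 < s)
    (fd : ℝ) (hfd : HasDirDeriv f y e fd) (hfd0 : 0 ≤ fd)
    (h80 : ∀ t : ℝ, |t| ≤ s * Real.sqrt (2 * (L : ℝ) / ε) →
      |f (y + t • e) - f y - fd * t| ≤ ε ^ 2 / (160 * (L : ℝ)) * |t|)
    (ξ : ℝ) (hξ₁ : -(s / 2) < ξ) (hξ₂ : ξ < s / 2) (lam : Y)
    (h160 : 240 * ε * s ≤ |f (y + lam) - f (y + ξ • e)|)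
    (hlamξ : ‖lam - ξ • e‖ ≤ s * Real.sqrt (ε / (L : ℝ)))
    (hup : ∀ sgn : ℝ, sgn = 1 ∨ sgn = -1 →
      ‖(sgn * s) • e + lam‖ / |sgn * s + ξ| ≤ 1 + ε / (4 * (L : ℝ))) :
    ∀ s₁ s₂ lam' : Y,
      max ‖s₁ - s • e‖ ‖s₂ - s • e‖ ≤ ε ^ 2 / (320 * (L : ℝ) ^ 2) * s →
      ‖lam' - lam‖ ≤ ε * s / (16 * (L : ℝ)) →
      ∃ y' ∈ segment ℝ (y - s₁) (y + lam') ∪ segment ℝ (y + lam') (y + s₂),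
        ∃ e' : Y, ‖e'‖ = 1 ∧ ∃ fd' : ℝ, HasDirDeriv f y' e' fd' ∧
          fd + ε ≤ fd' ∧
          ∀ t : ℝ, |(f (y' + t • e) - f y') - (f (y + t • e) - f y)| ≤
            25 * Real.sqrt ((fd' - fd) * (L : ℝ)) * |t| := by
  intro s₁ s₂ lam' hmax hlam'
  have hs₁ := (le_max_left _ _).trans hmax
  have hs₂ := (le_max_right _ _).trans hmax
  set r : ℝ := √(ε / (L : ℝ)) with hrdef
  have hr : 0 < r := by positivity
  have hr2 : r ^ 2 = ε / L := Real.sq_sqrt (by positivity)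
  have hεr : ε = L * r ^ 2 := by rw [hr2]; field_simp
  have hr3 : r < 1 / 3 := by
    rw [hrdef, Real.sqrt_lt' (by norm_num), div_lt_iff₀ hLpos]
    linarith
  have hf : ∀ x z, |f x - f z| ≤ L * ‖x - z‖ := by
    intro x z
    have := hL.dist_le_mul x z
    rwa [Real.dist_eq, dist_eq_norm] at this
  have hr2' : r ^ 2 ≤ r / 3 := by nlinarith
  have hr2'' : r ^ 2 ≤ 1 / 9 := by nlinarith
  have hr4 : r ^ 4 ≤ r ^ 2 / 9 := by nlinarith [pow_pos hr 2]
  -- rewrite everything in terms of r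
  have hc1 : ε ^ 2 / (320 * (L : ℝ) ^ 2) * s = r ^ 4 * s / 320 := by
    rw [hεr]; field_simp
  have hc2 : ε * s / (16 * (L : ℝ)) = r ^ 2 * s / 16 := by
    rw [hεr]; field_simp
  have hc3 : ε ^ 2 / (160 * (L : ℝ)) = L * r ^ 4 / 160 := by
    rw [hεr]; field_simp
  have hc4 : ε / (4 * (L : ℝ)) = r ^ 2 / 4 := by
    rw [hεr]; field_simp
  rw [hc1] at hs₁ hs₂
  rw [hc2] at hlam'
  rw [hc4] at hup
  have hfdL : fd ≤ L := by
    refine le_of_tendsto hfd ?_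
    filter_upwards [self_mem_nhdsWithin] with t ht
    have ht' : 0 < |t| := abs_pos.2 ht
    have := hf (y + t • e) y
    rw [add_sub_cancel_left, norm_smul, he, mul_one, Real.norm_eq_abs] at this
    refine (le_abs_self _).trans ?_
    rw [abs_div, div_le_iff₀ ht']
    exact this
  have h80' : ∀ t : ℝ, |t| ≤ 1.4 * s / r →
      |f (y + t • e) - f y - fd * t| ≤ L * r ^ 4 / 160 * |t| := by
    intro t ht
    rw [← hc3]
    apply h80
    refine ht.trans ?_
    have : 1.4 / r ≤ √(2 * (L : ℝ) / ε) := by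
      apply Real.le_sqrt_of_sq_le
      rw [div_pow, hεr]
      have : 2 * (L : ℝ) / (L * r ^ 2) = 2 / r ^ 2 := by field_simp
      rw [this]
      gcongr
      norm_num
    calc 1.4 * s / r = s * (1.4 / r) := by ring
      _ ≤ _ := by gcongr
  have hp1 : 0 < s + ξ := by linarith
  have hp2 : 0 < s - ξ := by linarith
  have hu1 : ‖s • e + lam‖ ≤ (1 + r ^ 2 / 4) * (s + ξ) := by
    have := hup 1 (Or.inl rfl)
    rw [one_mul, abs_of_pos hp1, div_le_iff₀ hp1] at this
    exact this
  have hu2 : ‖(-s) • e + lam‖ ≤ (1 + r ^ 2 / 4) * (s - ξ) := by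
    have := hup (-1) (Or.inr rfl)
    rw [neg_one_mul, abs_of_neg (by linarith), div_le_iff₀ (by linarith)] at this
    refine this.trans (le_of_eq ?_)
    ring
  have hr2s : 0 < r ^ 2 * s := by positivity
  have hr4s : r ^ 4 * s ≤ r ^ 2 * s / 9 := by
    have := mul_le_mul_of_nonneg_right hr4 hs.le
    linarith
  have hr2s' : r ^ 2 * s ≤ r * s / 3 := by
    have := mul_le_mul_of_nonneg_right hr2' hs.le
    linarith
  have hv1 : (s + ξ) • ((s + ξ)⁻¹ • (lam' + s₁)) = lam' + s₁ := smul_inv_smul₀ hp1.ne' _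
  have hv2 : (s - ξ) • ((s - ξ)⁻¹ • (s₂ - lam')) = s₂ - lam' := smul_inv_smul₀ hp2.ne' _
  have hlξ : ‖lam' - ξ • e‖ ≤ r ^ 2 * s / 16 + s * r := by
    have : lam' - ξ • e = (lam' - lam) + (lam - ξ • e) := by abel
    rw [this]
    exact (norm_add_le _ _).trans (add_le_add hlam' hlamξ)
  have hbig : 239 * (L * r ^ 2 * s) ≤ |f (y + lam') - f (y + ξ • e)| := by
    have e1 := hf (y + lam') (y + lam)
    rw [add_sub_add_left_eq_sub] at e1
    have e2 := e1.trans (mul_le_mul_of_nonneg_left hlam' hLpos.le)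
    have e3 : f (y + lam) - f (y + ξ • e) =
      (f (y + lam') - f (y + ξ • e)) - (f (y + lam') - f (y + lam)) := by ring
    rw [e3, hεr] at h160
    have e4 := abs_sub (f (y + lam') - f (y + ξ • e)) (f (y + lam') - f (y + lam))
    have : 0 < L * r ^ 2 * s := by positivity
    linarith
  have hq1 : r ^ 2 * s ≤ 2 * (r ^ 2 * (s + ξ)) := by
    have h : s ≤ 2 * (s + ξ) := by linarith
    have := mul_le_mul_of_nonneg_left h (pow_nonneg hr.le 2)
    linarith
  have hq2 : r ^ 2 * s ≤ 2 * (r ^ 2 * (s - ξ)) := by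
    have h : s ≤ 2 * (s - ξ) := by linarith
    have := mul_le_mul_of_nonneg_left h (pow_nonneg hr.le 2)
    linarith
  have hq3 : r * s ≤ 2 * (r * (s + ξ)) := by
    have h : s ≤ 2 * (s + ξ) := by linarith
    have := mul_le_mul_of_nonneg_left h hr.le
    linarith
  have hq4 : r * s ≤ 2 * (r * (s - ξ)) := by
    have h : s ≤ 2 * (s - ξ) := by linarith
    have := mul_le_mul_of_nonneg_left h hr.le
    linarith
  have key := core_s12 hLpos hf hr hr3 hs he hfd0 hfdL h80' hξ₁ hξ₂ (lam := lam')
    (v1 := (s + ξ)⁻¹ • (lam' + s₁)) (v2 := (s - ξ)⁻¹ • (s₂ - lam')) hbig (by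
      rw [norm_smul, norm_inv, Real.norm_eq_abs, abs_of_pos hp1, inv_mul_le_iff₀ hp1]
      have : lam' + s₁ = (s • e + lam) + (lam' - lam) + (s₁ - s • e) := by abel
      rw [this]
      refine norm_add₃_le.trans ?_
      linarith) (by
      rw [norm_smul, norm_inv, Real.norm_eq_abs, abs_of_pos hp2, inv_mul_le_iff₀ hp2]
      have : s₂ - lam' = (s₂ - s • e) - (lam' - lam) - ((-s) • e + lam) := by module
      rw [this]
      refine (norm_sub_le _ _).trans ?_
      have := norm_sub_le (s₂ - s • e) (lam' - lam)
      linarith) (by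
      have : (s + ξ)⁻¹ • (lam' + s₁) - e
          = (s + ξ)⁻¹ • ((lam' - ξ • e) + (s₁ - s • e)) := by
        rw [eq_inv_smul_iff₀ hp1.ne', smul_sub, hv1]; module
      rw [this, norm_smul, norm_inv, Real.norm_eq_abs, abs_of_pos hp1, inv_mul_le_iff₀ hp1]
      refine (norm_add_le _ _).trans ?_
      linarith) (by
      have : (s - ξ)⁻¹ • (s₂ - lam') - e
          = (s - ξ)⁻¹ • ((s₂ - s • e) - (lam' - ξ • e)) := by
        rw [eq_inv_smul_iff₀ hp2.ne', smul_sub, hv2]; module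
      rw [this, norm_smul, norm_inv, Real.norm_eq_abs, abs_of_pos hp2, inv_mul_le_iff₀ hp2]
      refine (norm_sub_le _ _).trans ?_
      linarith) (by
      rw [hv1]
      refine le_trans (le_of_eq ?_) hs₁
      rw [← norm_neg]
      congr 1
      module) (by
      rw [hv2]
      refine le_trans (le_of_eq ?_) hs₂
      congr 1
      module)
  rw [hv1, hv2, ← hεr] at key
  have g1 : y + (lam' - (lam' + s₁)) = y - s₁ := by abel
  have g2 : y + (lam' + (s₂ - lam')) = y + s₂ := by abel
  rw [g1, g2] at key
  exact key
end

section
/- Let (Y,‖·‖) be a Banach space whose norm is Fréchet differentiable on Y∖{0}. Let f : Y → ℝ be Lipschitz and (y,e) ∈ Y × S(Y) (with ‖e‖ = 1) be such that the directional derivative f'(y,e) exists and is non-negative. Suppose there is a family of sets {F_ε ⊆ Y : ε > 0} such that: (1) for all ε, θ > 0 there exists δ* = δ*(ε,θ) > 0 such that for every δ ∈ (0,δ*) the set F_ε is a δθ-wedge approximation for B(y,δ); and (2) whenever (y',e') ∈ F_ε × S(Y) is such that f'(y',e') exists, f'(y',e') ≥ f'(y,e), and |(f(y'+te) − f(y'))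 − (f(y+te) − f(y))| ≤ 25·√((f'(y',e') − f'(y,e))·Lip(f))·|t| for all t ∈ ℝ, then f'(y',e') < f'(y,e) + ε. Then f is Fréchet differentiable at y. -/
open Metric Set Filter

/-- The wedge `W(t) = [t₁,t₂] ∪ [t₂,t₃]` determined by a triple of points. -/
def wedge {Y : Type*} [NormedAddCommGroup Y] [NormedSpace ℝ Y] (t : Y × Y × Y) : Set Y :=
  segment ℝ t.1 t.2.1 ∪ segment ℝ t.2.1 t.2.2

/-- The standard wedge distance `max_{1≤i≤3} ‖t'ᵢ − tᵢ‖`. -/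
def wedgeDist {Y : Type*} [NormedAddCommGroup Y] (t s : Y × Y × Y) : ℝ :=
  max ‖t.1 - s.1‖ (max ‖t.2.1 - s.2.1‖ ‖t.2.2 - s.2.2‖)

/-- `S₁` is an `α`-wedge approximation for `S₂`. -/
def IsWedgeApprox {Y : Type*} [NormedAddCommGroup Y] [NormedSpace ℝ Y]
    (α : ℝ) (S₁ S₂ : Set Y) : Prop :=
  ∀ t : Y × Y × Y, wedge t ⊆ S₂ → ∃ t' : Y × Y × Y, wedge t' ⊆ S₁ ∧ wedgeDist t' t ≤ α



open MeasureTheory in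
lemma weak_type_aux (H : ℝ → ℝ) (a b : ℝ) (ν : Measure ℝ)
    (hν : ∀ x y, x ∈ Icc a b → y ∈ Icc a b → x ≤ y →
      ENNReal.ofReal |H y - H x| ≤ ν (Icc x y)) (s : ℝ) (hs : 0 < s) :
    ENNReal.ofReal s * volume {τ | τ ∈ Icc a b ∧ ∃ t ∈ Icc a b, s * |t - τ| < |H t - H τ|}
      ≤ 5 * ν (Icc a b) := by
  set U := {τ | τ ∈ Icc a b ∧ ∃ t ∈ Icc a b, s * |t - τ| < |H t - H τ|} with hU
  have hex : ∀ τ : ℝ, ∃ t : ℝ, τ ∈ U → t ∈ Icc a b ∧ s * |t - τ| < |H t - H τ| := by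
    intro τ
    by_cases h : τ ∈ U
    · obtain ⟨t, ht⟩ := h.2
      exact ⟨t, fun _ => ht⟩
    · exact ⟨0, fun h' => absurd h' h⟩
  choose t ht using hex
  have hball : ∀ τ, closedBall ((τ + t τ) / 2) (|t τ - τ| / 2) = Icc (min τ (t τ)) (max τ (t τ)) := by
    intro τ
    rw [Real.closedBall_eq_Icc]
    rcases le_total τ (t τ) with h | h
    · rw [min_eq_left h, max_eq_right h, abs_of_nonneg (by linarith)]
      congr 1 <;> ring
    · rw [min_eq_right h, max_eq_left h, abs_of_nonpos (by linarith)]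
      congr 1 <;> ring
  have hin : ∀ τ ∈ U, closedBall ((τ + t τ) / 2) (|t τ - τ| / 2) ⊆ Icc a b := by
    intro τ hτ
    rw [hball]
    exact Icc_subset_Icc (le_min hτ.1.1 (ht τ hτ).1.1) (max_le hτ.1.2 (ht τ hτ).1.2)
  have hpos : ∀ τ ∈ U, 0 < |t τ - τ| := by
    intro τ hτ
    rw [abs_pos]
    intro h0
    have := (ht τ hτ).2
    have h1 : t τ = τ := by linarith
    rw [h1] at this
    simp at this
  have hmeas : ∀ τ ∈ U, ENNReal.ofReal (s * |t τ - τ|) ≤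
      ν (closedBall ((τ + t τ) / 2) (|t τ - τ| / 2)) := by
    intro τ hτ
    rw [hball]
    refine (ENNReal.ofReal_le_ofReal (ht τ hτ).2.le).trans ?_
    rcases le_total τ (t τ) with h | h
    · rw [min_eq_left h, max_eq_right h]
      exact hν _ _ hτ.1 (ht τ hτ).1 h
    · rw [min_eq_right h, max_eq_left h, abs_sub_comm]
      exact hν _ _ (ht τ hτ).1 hτ.1 h
  obtain ⟨u, huU, hdisj, hcov⟩ := Vitali.exists_disjoint_subfamily_covering_enlargement_closedBall
    U (fun τ => (τ + t τ) / 2) (fun τ => |t τ - τ| / 2) ((b - a) / 2) (by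
      intro τ hτ
      have h1 := hτ.1
      have h2 := (ht τ hτ).1
      have : |t τ - τ| ≤ b - a := by
        rw [abs_le]; constructor <;> linarith [h1.1, h1.2, h2.1, h2.2]
      simpa using by linarith) 5 (by norm_num)
  have hcount : u.Countable := by
    refine hdisj.countable_of_nonempty_interior ?_
    intro τ hτ
    refine ⟨(τ + t τ) / 2, ?_⟩
    apply ball_subset_interior_closedBall
    exact mem_ball_self (by linarith [hpos τ (huU hτ)])
  have hsub : U ⊆ ⋃ τ ∈ u, closedBall ((τ + t τ) / 2) (5 * (|t τ - τ| / 2)) := by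
    intro τ hτ
    obtain ⟨σ, hσ, hsubs⟩ := hcov τ hτ
    refine mem_iUnion₂.2 ⟨σ, hσ, hsubs ?_⟩
    rw [hball]
    exact ⟨min_le_left _ _, le_max_left _ _⟩
  have hvol : volume U ≤ ∑' τ : u, volume (closedBall (((τ : ℝ) + t τ) / 2) (5 * (|t τ - τ| / 2))) :=
    (measure_mono hsub).trans (measure_biUnion_le volume hcount _)
  calc ENNReal.ofReal s * volume U
      ≤ ENNReal.ofReal s *
        ∑' τ : u, volume (closedBall (((τ : ℝ) + t τ) / 2) (5 * (|t τ - τ| / 2))) := by gcongr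
    _ = ∑' τ : u, 5 * ENNReal.ofReal (s * |t τ - τ|) := by
        rw [← ENNReal.tsum_mul_left]
        congr 1
        ext τ
        rw [Real.volume_closedBall, ← ENNReal.ofReal_mul hs.le,
          show (5 : ENNReal) = ENNReal.ofReal 5 by simp, ← ENNReal.ofReal_mul (by norm_num)]
        congr 1; ring
    _ ≤ ∑' τ : u, 5 * ν (closedBall (((τ : ℝ) + t τ) / 2) (|t τ - τ| / 2)) := by
        refine ENNReal.tsum_le_tsum fun τ => ?_
        gcongr
        exact hmeas τ (huU τ.2)
    _ = 5 * ν (⋃ τ ∈ u, closedBall ((τ + t τ) / 2) (|t τ - τ| / 2)) := by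
        rw [ENNReal.tsum_mul_left, measure_biUnion hcount hdisj
          (fun τ _ => measurableSet_closedBall)]
    _ ≤ 5 * ν (Icc a b) := by
        gcongr
        exact iUnion₂_subset fun τ hτ => hin τ (huU hτ)

open MeasureTheory in
lemma lintegral_rpow_aux (A : ℝ) (hA : 0 ≤ A) :
    ∫⁻ x in Ioc 0 A, ENNReal.ofReal (x ^ (-(1/2) : ℝ)) = ENNReal.ofReal (2 * Real.sqrt A) := by
  have h := intervalIntegral.intervalIntegrable_rpow' (a := 0) (b := A) (r := -(1/2)) (by norm_num)
  rw [intervalIntegrable_iff_integrableOn_Ioc_of_le hA] at h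
  rw [← ofReal_integral_eq_lintegral_ofReal h]
  · rw [← intervalIntegral.integral_of_le hA, integral_rpow (Or.inl (by norm_num)),
      Real.sqrt_eq_rpow]
    congr 1
    rw [Real.zero_rpow (by norm_num)]
    norm_num
    ring
  · filter_upwards [ae_restrict_mem measurableSet_Ioc] with x hx
    exact Real.rpow_nonneg hx.1.le _

open MeasureTheory in
lemma real_lemma (H : ℝ → ℝ) (M : NNReal) (hM : 0 < M) (hH : LipschitzWith M H)
    (a b : ℝ) (hab : a < b) (m : ℝ) (hm : 0 < m) (h1 : H a - H b ≤ m)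
    (ξ : ℝ) (hξ : ξ ∈ Icc a b) (h2 : m ≤ H ξ - H a ∨ m ≤ H b - H ξ)
    (N : Set ℝ) (hN : volume N ≤ ENNReal.ofReal (m / (6 * M))) :
    ∃ τ ∈ Icc a b, τ ∉ N ∧ ∃ d, HasDerivAt H d τ ∧ m / (6 * (b - a)) ≤ d ∧
      ∀ t ∈ Icc a b, |H t - H τ| ≤ Real.sqrt (60 * d * M) * |t - τ| := by
  by_contra hcon
  push Not at hcon
  have hMr : (0 : ℝ) < M := hM
  set g := deriv H with hg
  have hgM : ∀ x, |g x| ≤ M := fun x => by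
    simpa using norm_deriv_le_of_lipschitz (x₀ := x) hH
  have hgmeas : Measurable g := measurable_deriv H
  have hbd : ∀ (k : ℝ → ℝ), Measurable k → (∀ x, |k x| ≤ M) → ∀ x y, 
      IntervalIntegrable k volume x y := by
    intro k hk hkM x y
    rw [intervalIntegrable_iff]
    refine Measure.integrableOn_of_bounded (M := M) (by simp) hk.aestronglyMeasurable ?_
    exact Eventually.of_forall fun z => by simpa using hkM z
  have hgi := hbd g hgmeas hgM
  have hai := hbd (fun x => |g x|) (by fun_prop) (fun x => by simpa using hgM x)
  have hpi := hbd (fun x => max (g x) 0) (by fun_prop) (fun x => by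
    rw [abs_of_nonneg (le_max_right _ _)]
    exact max_le ((le_abs_self _).trans (hgM x)) hMr.le)
  have ftc : ∀ x y, ∫ z in x..y, g z = H y - H x := fun x y =>
    (hH.lipschitzOnWith.absolutelyContinuousOnInterval).integral_deriv_eq_sub
  set P := ∫ x in a..b, max (g x) 0 with hP
  set V := ∫ x in a..b, |g x| with hV
  have hle : ∀ x y, x ≤ y → H y - H x ≤ ∫ z in x..y, max (g z) 0 := by
    intro x y hxy
    rw [← ftc]
    exact intervalIntegral.integral_mono_on hxy (hgi _ _) (hpi _ _) (fun z _ => le_max_left _ _)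
  have hnn : ∀ x y, x ≤ y → 0 ≤ ∫ z in x..y, max (g z) 0 := fun x y hxy =>
    intervalIntegral.integral_nonneg hxy (fun z _ => le_max_right _ _)
  have hPm : m ≤ P := by
    have hsplit : (∫ z in a..ξ, max (g z) 0) + (∫ z in ξ..b, max (g z) 0) = P :=
      intervalIntegral.integral_add_adjacent_intervals (hpi _ _) (hpi _ _)
    have e1 := hle a ξ hξ.1
    have e2 := hle ξ b hξ.2
    have e3 := hnn a ξ hξ.1
    have e4 := hnn ξ b hξ.2
    rcases h2 with h | h <;> linarith
  have hVP : V ≤ 3 * P := by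
    have : V = 2 * P - (H b - H a) := by
      rw [← ftc, hV, hP, ← intervalIntegral.integral_const_mul,
        ← intervalIntegral.integral_sub ((hpi _ _).const_mul 2) (hgi _ _)]
      congr 1
      ext x
      rcases le_total (g x) 0 with h | h
      · rw [max_eq_right h, abs_of_nonpos h]; ring
      · rw [max_eq_left h, abs_of_nonneg h]; ring
    linarith
  have hV0 : 0 ≤ V := intervalIntegral.integral_nonneg hab.le (fun z _ => abs_nonneg _)
  -- the measure
  set ν : Measure ℝ := volume.withDensity (fun x => ENNReal.ofReal |g x|) with hνdef
  have hνI : ∀ x y, x ≤ y → ν (Icc x y) = ENNReal.ofReal (∫ z in x..y, |g z|) := by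
    intro x y hxy
    rw [hνdef, withDensity_apply _ measurableSet_Icc, intervalIntegral.integral_of_le hxy,
      ← integral_Icc_eq_integral_Ioc, ofReal_integral_eq_lintegral_ofReal]
    · have := hai x y
      rwa [intervalIntegrable_iff_integrableOn_Icc_of_le hxy] at this
    · exact Eventually.of_forall fun z => abs_nonneg _
  have hwt := weak_type_aux H a b ν (by
    intro x y _ _ hxy
    rw [hνI x y hxy, ← ftc]
    exact ENNReal.ofReal_le_ofReal (intervalIntegral.abs_integral_le_integral_abs hxy))
  rw [hνI a b hab.le, ← hV] at hwt
  set l0 := m / (6 * (b - a)) with hl0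
  have hl0pos : 0 < l0 := div_pos hm (by linarith)
  -- pointwise bound
  have key : ∀ l ∈ Ioi (0 : ℝ), (volume.restrict (Icc a b)) {x | l < max (g x) 0} ≤
      (Ioc 0 l0).indicator (fun _ => ENNReal.ofReal (b - a)) l +
      (Ioc 0 (M : ℝ)).indicator (fun _ => ENNReal.ofReal (m / (6 * M))) l +
      (Ioc 0 ((M : ℝ) / 60)).indicator
        (fun l => ENNReal.ofReal (5 * V / Real.sqrt (60 * M)) * ENNReal.ofReal (l ^ (-(1/2) : ℝ))) l := by
    intro l hl
    have hl' : 0 < l := hl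
    rcases le_or_gt l l0 with hll | hll
    · rw [indicator_of_mem (show l ∈ Ioc 0 l0 from ⟨hl, hll⟩), add_assoc]
      refine le_trans ?_ le_self_add
      refine (measure_mono (subset_univ _)).trans ?_
      simp
    rcases le_or_gt l M with hlM | hlM
    swap
    · have : {x | l < max (g x) 0} = ∅ := by
        ext x
        simp only [mem_ofPred_eq, mem_empty_iff_false, iff_false, not_lt]
        exact (max_le ((le_abs_self _).trans (hgM x)) hMr.le).trans hlM.le
      rw [this]; simp
    rw [indicator_of_mem (show l ∈ Ioc 0 (M : ℝ) from ⟨hl, hlM⟩), add_assoc]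
    refine le_trans ?_ le_add_self
    set U := {τ | τ ∈ Icc a b ∧ ∃ t ∈ Icc a b, Real.sqrt (60 * l * M) * |t - τ| < |H t - H τ|} with hU
    have hsub : (volume.restrict (Icc a b)) {x | l < max (g x) 0} ≤ volume (N ∪ U) := by
      refine (measure_mono_ae ?_).trans (Measure.restrict_apply_le (Icc a b) (N ∪ U))
      have hd := ae_restrict_of_ae (s := Icc a b) hH.ae_differentiableAt_real
      filter_upwards [hd, ae_restrict_mem measurableSet_Icc] with x hx hxI hlx
      have hlx' : l < g x := by
        have hlx2 : l < max (g x) 0 := hlx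
        rcases lt_max_iff.1 hlx2 with h | h
        · exact h
        · linarith
      by_cases hxN : x ∈ N
      · exact Or.inl hxN
      right
      obtain ⟨t, htI, ht⟩ := hcon x hxI hxN (g x) hx.hasDerivAt (by linarith)
      refine ⟨hxI, t, htI, lt_of_le_of_lt ?_ ht⟩
      gcongr
    refine hsub.trans ((measure_union_le _ _).trans (add_le_add hN ?_))
    have hs : 0 < Real.sqrt (60 * l * M) := by positivity
    rcases le_or_gt l ((M : ℝ) / 60) with hlM2 | hlM2
    · rw [indicator_of_mem (show l ∈ Ioc 0 ((M : ℝ) / 60) from ⟨hl, hlM2⟩)]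
      have := hwt _ hs
      rw [← ENNReal.ofReal_mul (by positivity)]
      rw [mul_comm, ← ENNReal.le_div_iff_mul_le (Or.inl (ENNReal.ofReal_pos.2 hs).ne')
        (Or.inl ENNReal.ofReal_ne_top),
        show (5 : ENNReal) = ENNReal.ofReal 5 by simp, ← ENNReal.ofReal_mul (by norm_num),
        ← ENNReal.ofReal_div_of_pos hs] at this
      refine this.trans (le_of_eq ?_)
      congr 1
      rw [show 60 * l * M = 60 * M * l by ring, Real.sqrt_mul (by positivity),
        Real.rpow_neg hl'.le, ← Real.sqrt_eq_rpow]
      field_simp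
    · have : U = ∅ := by
        ext x
        simp only [hU, mem_ofPred_eq, mem_empty_iff_false, iff_false]
        rintro ⟨_, t, _, ht⟩
        have hlip := hH.dist_le_mul t x
        rw [Real.dist_eq, Real.dist_eq] at hlip
        have : (M : ℝ) ≤ Real.sqrt (60 * l * M) := by
          apply Real.le_sqrt_of_sq_le
          nlinarith
        nlinarith [abs_nonneg (t - x)]
      rw [this]; simp
  have hfin : ENNReal.ofReal P ≤ ENNReal.ofReal (m / 6 + m / 6 + V / 6) := by
    calc ENNReal.ofReal P = ∫⁻ x in Icc a b, ENNReal.ofReal (max (g x) 0) := by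
          rw [hP, intervalIntegral.integral_of_le hab.le,
            ← integral_Icc_eq_integral_Ioc, ofReal_integral_eq_lintegral_ofReal]
          · have := hpi a b
            rwa [intervalIntegrable_iff_integrableOn_Icc_of_le hab.le] at this
          · exact Eventually.of_forall fun z => le_max_right _ _
      _ = ∫⁻ l in Ioi 0, (volume.restrict (Icc a b)) {x | l < max (g x) 0} :=
          lintegral_eq_lintegral_meas_lt _ (Eventually.of_forall fun z => le_max_right _ _)
            (by fun_prop)
      _ ≤ ∫⁻ l in Ioi 0, ((Ioc 0 l0).indicator (fun _ => ENNReal.ofReal (b - a)) l +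
            (Ioc 0 (M : ℝ)).indicator (fun _ => ENNReal.ofReal (m / (6 * M))) l +
            (Ioc 0 ((M : ℝ) / 60)).indicator
            (fun l => ENNReal.ofReal (5 * V / Real.sqrt (60 * M)) *
              ENNReal.ofReal (l ^ (-(1/2) : ℝ))) l) :=
          setLIntegral_mono' measurableSet_Ioi key
      _ ≤ ∫⁻ l, ((Ioc 0 l0).indicator (fun _ => ENNReal.ofReal (b - a)) l +
            (Ioc 0 (M : ℝ)).indicator (fun _ => ENNReal.ofReal (m / (6 * M))) l +
            (Ioc 0 ((M : ℝ) / 60)).indicator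
            (fun l => ENNReal.ofReal (5 * V / Real.sqrt (60 * M)) *
              ENNReal.ofReal (l ^ (-(1/2) : ℝ))) l) := setLIntegral_le_lintegral _ _
      _ = ENNReal.ofReal (b - a) * ENNReal.ofReal l0 +
          ENNReal.ofReal (m / (6 * M)) * ENNReal.ofReal M +
          ENNReal.ofReal (5 * V / Real.sqrt (60 * M)) *
            ENNReal.ofReal (2 * Real.sqrt ((M : ℝ) / 60)) := by
          rw [lintegral_add_left, lintegral_add_left, lintegral_indicator measurableSet_Ioc,
            lintegral_indicator measurableSet_Ioc, lintegral_indicator measurableSet_Ioc,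
            lintegral_const_mul, lintegral_rpow_aux _ (by positivity)]
          · simp
          · fun_prop
          · exact measurable_const.indicator measurableSet_Ioc
          · exact (measurable_const.indicator measurableSet_Ioc).add
              (measurable_const.indicator measurableSet_Ioc)
      _ = ENNReal.ofReal (m / 6 + m / 6 + V / 6) := by
          have hba : 0 < b - a := by linarith
          rw [← ENNReal.ofReal_mul (by positivity), ← ENNReal.ofReal_mul (by positivity),
            ← ENNReal.ofReal_mul (by positivity), ← ENNReal.ofReal_add (by positivity) (by positivity),
            ← ENNReal.ofReal_add (by positivity) (by positivity)]
          congr 1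
          have e1 : (b - a) * l0 = m / 6 := by rw [hl0]; field_simp
          have e2 : m / (6 * M) * M = m / 6 := by field_simp
          have e3 : Real.sqrt ((M : ℝ) / 60) = Real.sqrt (60 * M) / 60 := by
            rw [show (M : ℝ) / 60 = (60 * M) / 60 ^ 2 by ring, Real.sqrt_div (by positivity),
              Real.sqrt_sq (by norm_num)]
          have e4 : 0 < Real.sqrt (60 * M) := by positivity
          rw [e1, e2, e3]
          field_simp
          ring
  rw [ENNReal.ofReal_le_ofReal_iff (by positivity)] at hfin
  linarith

lemma hasDirDeriv_of_hasDerivAt {Y : Type*} [NormedAddCommGroup Y] [NormedSpace ℝ Y]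
    (f : Y → ℝ) (y e : Y) (d : ℝ) (h : HasDerivAt (fun t : ℝ => f (y + t • e)) d 0) :
    HasDirDeriv f y e d := by
  rw [hasDerivAt_iff_tendsto_slope_zero] at h
  unfold HasDirDeriv
  refine h.congr fun t => ?_
  simp [div_eq_inv_mul]

lemma hasDerivAt_of_hasDirDeriv {Y : Type*} [NormedAddCommGroup Y] [NormedSpace ℝ Y]
    (f : Y → ℝ) (y e : Y) (d : ℝ) (h : HasDirDeriv f y e d) :
    HasDerivAt (fun t : ℝ => f (y + t • e)) d 0 := by
  rw [hasDerivAt_iff_tendsto_slope_zero]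
  unfold HasDirDeriv at h
  refine h.congr fun t => ?_
  simp [div_eq_inv_mul]

/-- the broken line through `p` at time `ξ` with velocities `v1`, `v2`. -/
noncomputable def broken {Y : Type*} [NormedAddCommGroup Y] [NormedSpace ℝ Y]
    (p v1 v2 : Y) (ξ t : ℝ) : Y := p + min (t - ξ) 0 • v1 + max (t - ξ) 0 • v2

lemma broken_diff {Y : Type*} [NormedAddCommGroup Y] [NormedSpace ℝ Y]
    (p v1 v2 w : Y) (ξ t s B : ℝ) (h1 : ‖v1 - w‖ ≤ B) (h2 : ‖v2 - w‖ ≤ B) :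
    ‖broken p v1 v2 ξ t - broken p v1 v2 ξ s - (t - s) • w‖ ≤ B * |t - s| := by
  have e1 : broken p v1 v2 ξ t - broken p v1 v2 ξ s - (t - s) • w =
      (min (t - ξ) 0 - min (s - ξ) 0) • (v1 - w) + (max (t - ξ) 0 - max (s - ξ) 0) • (v2 - w) := by
    have : t - s = (min (t - ξ) 0 - min (s - ξ) 0) + (max (t - ξ) 0 - max (s - ξ) 0) := by
      have a1 := min_add_max (t - ξ) 0
      have a2 := min_add_max (s - ξ) 0
      linarith
    rw [this]
    unfold broken
    module
  have e2 : |min (t - ξ) 0 - min (s - ξ) 0| + |max (t - ξ) 0 - max (s - ξ) 0| = |t - s| := by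
    rcases le_total (t - ξ) 0 with h | h <;> rcases le_total (s - ξ) 0 with h' | h' <;>
    simp only [min_eq_left h, min_eq_right h, max_eq_left h, max_eq_right h,
      min_eq_left h', min_eq_right h', max_eq_left h', max_eq_right h']
    · rw [sub_self, abs_zero, add_zero]; congr 1; ring
    · rw [abs_of_nonpos (by linarith), abs_of_nonpos (by linarith), abs_of_nonpos (by linarith)]
      ring
    · rw [abs_of_nonneg (by linarith), abs_of_nonneg (by linarith), abs_of_nonneg (by linarith)]
      ring
    · rw [sub_self, abs_zero, zero_add]; congr 1; ring
  rw [e1]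
  refine (norm_add_le _ _).trans ?_
  rw [norm_smul, norm_smul, Real.norm_eq_abs, Real.norm_eq_abs, ← e2, mul_add]
  rw [mul_comm B, mul_comm B]
  gcongr

/-- directional derivative from the derivative along the broken line -/
lemma dirDeriv_broken {Y : Type*} [NormedAddCommGroup Y] [NormedSpace ℝ Y]
    (f : Y → ℝ) (γ : ℝ → Y) (v : Y) (hv : 0 < ‖v‖) (fd d τ : ℝ)
    (hd : HasDerivAt (fun t => f (γ t) - fd * t) d τ)
    (hγ : ∀ᶠ t in nhds τ, γ t = γ τ + (t - τ) • v) :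
    HasDirDeriv f (γ τ) (‖v‖⁻¹ • v) ((fd + d) / ‖v‖) := by
  apply hasDirDeriv_of_hasDerivAt
  have h1 : HasDerivAt (fun t => f (γ t)) (fd + d) τ := by
    have := hd.add ((hasDerivAt_id τ).const_mul fd)
    have h2 : (fun t => f (γ t)) = (fun t => f (γ t) - fd * t) + fun t => fd * id t := by
      ext t; simp
    rw [h2]
    rw [mul_one, add_comm d fd] at this
    exact this
  have h2 : HasDerivAt (fun t => f (γ τ + (t - τ) • v)) (fd + d) τ := by
    refine h1.congr_of_eventuallyEq ?_
    filter_upwards [hγ] with t ht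
    rw [ht]
  have h3 : HasDerivAt (fun s : ℝ => τ + s * ‖v‖⁻¹) ‖v‖⁻¹ 0 := by
    simpa using ((hasDerivAt_id (0:ℝ)).mul_const ‖v‖⁻¹).const_add τ
  have h4 : HasDerivAt (fun t => f (γ τ + (t - τ) • v)) (fd + d) ((fun s : ℝ => τ + s * ‖v‖⁻¹) 0) := by
    simpa using h2
  have h5 := h4.comp 0 h3
  rw [div_eq_mul_inv]
  have h6 : (fun t : ℝ => f (γ τ + t • ‖v‖⁻¹ • v)) =
      (fun t => f (γ τ + (t - τ) • v)) ∘ fun s => τ + s * ‖v‖⁻¹ := by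
    ext s
    simp [smul_smul]
  rw [h6]
  exact h5

set_option maxHeartbeats 2000000 in
lemma core_s13 {Y : Type*} [NormedAddCommGroup Y] [NormedSpace ℝ Y]
    (f : Y → ℝ) (L : ℝ) (hL0 : 0 < L) (hL : ∀ x z, |f x - f z| ≤ L * ‖x - z‖)
    (y e : Y) (he : ‖e‖ = 1) (fd : ℝ) (hfd0 : 0 ≤ fd) (hfdL : fd ≤ L)
    (ρ ξ α β ω σ m d0 s0 κ n : ℝ) (hρ : 0 < ρ) (hξ : |ξ| ≤ ρ / 2)
    (p1 p2 p3 : Y) (hp1 : ‖p1 - (y - ρ • e)‖ ≤ α) (hp3 : ‖p3 - (y + ρ • e)‖ ≤ α)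
    (v1 v2 : Y) (hv1 : p1 = p2 - (ξ + ρ) • v1) (hv2 : p3 = p2 + (ρ - ξ) • v2)
    (hv1β : ‖v1‖ ≤ 1 + β) (hv2β : ‖v2‖ ≤ 1 + β) (hv1ω : ‖v1 - e‖ ≤ ω) (hv2ω : ‖v2 - e‖ ≤ ω)
    (hm : 0 < m) (hmσ : σ * ρ + L * α ≤ m / 4) (hfar : 3 * m / 2 ≤ |f p2 - fd * ξ - f y|)
    (hd0 : d0 = m / (12 * ρ)) (hβ0 : 0 ≤ β) (hβ : β ≤ 1 / 10) (hβL : β * L ≤ d0 / 10)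
    (hs0 : 0 < s0) (hs0d : s0 ^ 2 ≤ d0 * L / 2) (hω : L * ω ≤ s0) (hω' : ω ≤ 1 / 4)
    (hσ0 : 0 ≤ σ) (hσ : σ ≤ s0) (hκ : 0 < κ) (hκm : 2 * κ ≤ m / (18 * L))
    (hακ : 2 * L * α + 2 * σ * ρ ≤ s0 * κ) (hαρ : α ≤ ρ / 2)
    (hn : 1 ≤ n) (hn' : 4 * L ≤ s0 * n) (hn2 : 2 ≤ n)
    (hψ : ∀ t : ℝ, |t| ≤ (n + 1) * ρ → |f (y + t • e) - f y - fd * t| ≤ σ * |t|) :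
    ∃ y' ∈ wedge (p1, p2, p3), ∃ e' : Y, ‖e'‖ = 1 ∧ ∃ fd' : ℝ, HasDirDeriv f y' e' fd' ∧
      fd + d0 / 2 ≤ fd' ∧
      ∀ t : ℝ, |(f (y' + t • e) - f y') - (f (y + t • e) - f y)| ≤
          25 * Real.sqrt ((fd' - fd) * L) * |t| := by
  obtain ⟨hξ1, hξ2⟩ := abs_le.1 hξ
  set γ := broken p2 v1 v2 ξ with hγ
  have hγ1 : γ (-ρ) = p1 := by
    rw [hγ, hv1]; unfold broken
    rw [min_eq_left (by linarith), max_eq_right (by linarith)]; module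
  have hγ3 : γ ρ = p3 := by
    rw [hγ, hv2]; unfold broken
    rw [min_eq_right (by linarith), max_eq_left (by linarith)]; module
  have hγ2 : γ ξ = p2 := by
    rw [hγ]; unfold broken; simp
  have hγL : ∀ t s, ‖γ t - γ s‖ ≤ (1 + β) * |t - s| := by
    intro t s
    have := broken_diff p2 v1 v2 0 ξ t s (1 + β) (by simpa using hv1β) (by simpa using hv2β)
    simpa using this
  have hγe : ∀ t s, ‖γ t - γ s - (t - s) • e‖ ≤ ω * |t - s| := fun t s =>
    broken_diff p2 v1 v2 e ξ t s ω hv1ω hv2ω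
  have hω0 : 0 ≤ ω := (norm_nonneg _).trans hv1ω
  have hα0 : 0 ≤ α := (norm_nonneg _).trans hp1
  have hd0pos : 0 < d0 := by rw [hd0]; positivity
  set H : ℝ → ℝ := fun t => f (γ t) - fd * t with hH
  obtain ⟨M, hM⟩ : ∃ M : NNReal, (M : ℝ) = 3 * L := ⟨⟨3 * L, by positivity⟩, rfl⟩
  have hHlip : LipschitzWith M H := by
    apply LipschitzWith.of_dist_le_mul
    intro t s
    rw [Real.dist_eq, Real.dist_eq]
    have e1 : H t - H s = (f (γ t) - f (γ s)) - fd * (t - s) := by simp only [hH]; ring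
    have e2 : |f (γ t) - f (γ s)| ≤ L * ((1 + β) * |t - s|) :=
      (hL _ _).trans (by gcongr; exact hγL t s)
    have e3 : |fd * (t - s)| ≤ L * |t - s| := by
      rw [abs_mul, abs_of_nonneg hfd0]; gcongr
    rw [e1]
    have e4 := abs_sub (f (γ t) - f (γ s)) (fd * (t - s))
    have e5 : L * β * |t - s| ≤ L * 1 * |t - s| := by gcongr; linarith
    rw [hM]
    nlinarith [abs_nonneg (t - s)]
  -- values at the ends
  have hend : ∀ q, q = ρ ∨ q = -ρ → |H q - f y| ≤ σ * ρ + L * α ∧ ‖γ q - (y + q • e)‖ ≤ α := by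
    intro q hq
    have h1 : ‖γ q - (y + q • e)‖ ≤ α := by
      rcases hq with rfl | rfl
      · rw [hγ3]; exact hp3
      · rw [hγ1, neg_smul, ← sub_eq_add_neg]; exact hp1
    have h2 : |q| = ρ := by rcases hq with rfl | rfl <;> simp [abs_of_pos hρ]
    refine ⟨?_, h1⟩
    have h3 := hψ q (by rw [h2]; nlinarith)
    rw [h2] at h3
    have h4 : |f (γ q) - f (y + q • e)| ≤ L * α := (hL _ _).trans (by gcongr)
    have : H q - f y = (f (γ q) - f (y + q • e)) + (f (y + q • e) - f y - fd * q) := by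
      simp only [hH]; ring
    rw [this]
    exact (abs_add_le _ _).trans (by linarith)
  have hendp := abs_le.1 (hend ρ (Or.inl rfl)).1
  have hendm := abs_le.1 (hend (-ρ) (Or.inr rfl)).1
  have hHξ : H ξ = f p2 - fd * ξ := by simp only [hH, hγ2]
  obtain ⟨τ, hτI, hτN, d, hd, hdle, hdH⟩ := real_lemma H M
    (by rw [← NNReal.coe_pos, hM]; positivity) hHlip (-ρ) ρ (by linarith) m hm
    (by linarith) ξ ⟨by linarith, by linarith⟩ (by
      rw [hHξ]
      rcases le_abs.1 hfar with h | h
      · left; linarith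
      · right; linarith) (Ico (-ρ) (-ρ + κ) ∪ Ioc (ρ - κ) ρ ∪ {ξ}) (by
      refine (MeasureTheory.measure_union_le _ _).trans ?_
      rw [Real.volume_singleton, add_zero]
      refine (MeasureTheory.measure_union_le _ _).trans ?_
      rw [Real.volume_Ico, Real.volume_Ioc, ← ENNReal.ofReal_add (by linarith) (by linarith)]
      apply ENNReal.ofReal_le_ofReal
      rw [hM, show 6 * (3 * L) = 18 * L by ring]
      linarith)
  rw [hM] at hdH
  have hd0d : d0 ≤ d := by
    rw [hd0]; rw [show (12 * ρ) = 6 * (ρ - -ρ) by ring]; exact hdle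
  have hdpos : 0 < d := by linarith
  have hτξ : τ ≠ ξ := fun h => hτN (Or.inr h)
  have hτ1 : -ρ + κ ≤ τ := by
    by_contra h
    exact hτN (Or.inl (Or.inl ⟨hτI.1, by linarith⟩))
  have hτ2 : τ ≤ ρ - κ := by
    by_contra h
    exact hτN (Or.inl (Or.inr ⟨by linarith, hτI.2⟩))
  -- local direction
  obtain ⟨v, hvβ, hvω, hmem, hloc⟩ : ∃ v : Y, ‖v‖ ≤ 1 + β ∧ ‖v - e‖ ≤ ω ∧
      γ τ ∈ wedge (p1, p2, p3) ∧ ∀ᶠ t in nhds τ, γ t = γ τ + (t - τ) • v := by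
    rcases lt_or_gt_of_ne hτξ with h | h
    · refine ⟨v1, hv1β, hv1ω, Or.inl ?_, ?_⟩
      · rw [segment_symm, segment_eq_image']
        have hp : 0 < ξ + ρ := by linarith
        refine ⟨(ξ - τ) / (ξ + ρ), ⟨by apply div_nonneg <;> linarith, ?_⟩, ?_⟩
        · rw [div_le_one hp]; linarith [hτI.1]
        · simp only [hγ, hv1, broken]
          rw [min_eq_left (by linarith), max_eq_right (by linarith)]
          rw [sub_sub_cancel_left, smul_neg, smul_smul, div_mul_cancel₀ _ hp.ne']
          module
      · filter_upwards [Iio_mem_nhds h] with t ht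
        have ht' : t < ξ := ht
        simp only [hγ, broken]
        rw [min_eq_left (by linarith), max_eq_right (by linarith),
          min_eq_left (by linarith), max_eq_right (by linarith)]
        module
    · refine ⟨v2, hv2β, hv2ω, Or.inr ?_, ?_⟩
      · rw [segment_eq_image']
        have hp : 0 < ρ - ξ := by linarith
        refine ⟨(τ - ξ) / (ρ - ξ), ⟨by apply div_nonneg <;> linarith, ?_⟩, ?_⟩
        · rw [div_le_one hp]; linarith [hτI.2]
        · simp only [hγ, hv2, broken]
          rw [min_eq_right (by linarith), max_eq_left (by linarith)]
          rw [add_sub_cancel_left, smul_smul, div_mul_cancel₀ _ hp.ne']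
          module
      · filter_upwards [Ioi_mem_nhds h] with t ht
        have ht' : ξ < t := ht
        simp only [hγ, broken]
        rw [min_eq_right (by linarith), max_eq_left (by linarith),
          min_eq_right (by linarith), max_eq_left (by linarith)]
        module
  have hvpos : 0 < ‖v‖ := by
    have h1 : ‖e‖ ≤ ‖v‖ + ‖v - e‖ := by
      have := norm_sub_le v (v - e)
      simpa using this
    linarith
  have hdir := dirDeriv_broken f γ v hvpos fd d τ hd hloc
  set fd' := (fd + d) / ‖v‖ with hfd'
  have hD : fd + 3 / 4 * d ≤ fd' := by
    rw [hfd', le_div_iff₀ hvpos]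
    have h1 : (fd + 3 / 4 * d) * ‖v‖ ≤ (fd + 3 / 4 * d) * (1 + β) := by gcongr
    have h2 : fd * β ≤ L * β := by gcongr
    have h3 : d * β ≤ d * (1 / 10) := by gcongr
    nlinarith
  set S := Real.sqrt ((fd' - fd) * L) with hS
  have hs0S : s0 ≤ S := by
    apply Real.le_sqrt_of_sq_le
    have : d0 / 2 * L ≤ (fd' - fd) * L := by
      gcongr; linarith
    linarith
  have hSM : Real.sqrt (60 * d * (3 * L)) ≤ 16 * S := by
    rw [Real.sqrt_le_iff]
    refine ⟨by positivity, ?_⟩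
    rw [mul_pow, hS, Real.sq_sqrt (by apply mul_nonneg <;> linarith)]
    have : 3 / 4 * d * L ≤ (fd' - fd) * L := by
      gcongr; linarith
    nlinarith [mul_pos hdpos hL0]
  have hSpos : 0 < S := by linarith
  have hdH' : ∀ t ∈ Icc (-ρ) ρ, |H t - H τ| ≤ 16 * S * |t - τ| := by
    intro t ht
    refine (hdH t ht).trans ?_
    gcongr
  refine ⟨γ τ, hmem, ‖v‖⁻¹ • v, by rw [norm_smul, norm_inv, norm_norm, inv_mul_cancel₀ hvpos.ne'],
    fd', hdir, by linarith, ?_⟩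
  intro t
  -- outside
  have case2 : ∀ q, q = ρ ∨ q = -ρ → |q - τ| ≤ |t| → κ ≤ |t| → |t| ≤ n * ρ →
      |(f (γ τ + t • e) - f (γ τ)) - (f (y + t • e) - f y)| ≤ 25 * S * |t| := by
    intro q hq hqt hκt htn
    obtain ⟨hq1, hq2⟩ := hend q hq
    have hqI : q ∈ Icc (-ρ) ρ := by rcases hq with rfl | rfl <;> constructor <;> linarith
    have a1 : |H q - H τ| ≤ 16 * S * |t| := (hdH' q hqI).trans (by gcongr)
    have hτabs : |τ| ≤ ρ := abs_le.2 hτI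
    have htτ : |τ + t| ≤ ρ + |t| := (abs_add_le _ _).trans (by linarith)
    have a2 : |f (y + (τ + t) • e) - f y - fd * (τ + t)| ≤ σ * (ρ + |t|) :=
      (hψ (τ + t) (by linarith)).trans (by gcongr)
    have a3 : |f (y + t • e) - f y - fd * t| ≤ σ * |t| := hψ t (by linarith)
    have a4 : ‖(γ τ + t • e) - (y + (τ + t) • e)‖ ≤ α + ω * |t| := by
      have : (γ τ + t • e) - (y + (τ + t) • e) =
          (γ q - (y + q • e)) - (γ q - γ τ - (q - τ) • e) := by module
      rw [this]
      refine (norm_sub_le _ _).trans (add_le_add hq2 ((hγe q τ).trans ?_))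
      gcongr
    have a5 : |f (γ τ + t • e) - f (y + (τ + t) • e)| ≤ L * (α + ω * |t|) :=
      (hL _ _).trans (by gcongr)
    have a6 : L * ω * |t| ≤ s0 * |t| := by gcongr
    have a7 : s0 * κ ≤ s0 * |t| := by gcongr
    have a8 : σ * |t| ≤ s0 * |t| := by gcongr
    have a9 : s0 * |t| ≤ S * |t| := by gcongr
    have heq : (f (γ τ + t • e) - f (γ τ)) - (f (y + t • e) - f y) =
        (f (γ τ + t • e) - f (y + (τ + t) • e)) + (f (y + (τ + t) • e) - f y - fd * (τ + t))
        - (f (y + t • e) - f y - fd * t) + (H q - H τ) - (H q - f y) := by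
      simp only [hH]; ring
    rw [heq]
    rw [abs_le] at a1 a2 a3 a5 hq1 ⊢
    have a0 := mul_nonneg hSpos.le (abs_nonneg t)
    constructor <;> linarith [a1.1, a1.2, a2.1, a2.2, a3.1, a3.2, a5.1, a5.2, hq1.1, hq1.2]
  by_cases hbig : n * ρ < |t|
  · have hy : ‖γ τ - y‖ ≤ 2 * ρ := by
      have : γ τ - y = (γ ρ - (y + ρ • e)) - (γ ρ - γ τ - (ρ - τ) • e) + τ • e := by module
      rw [this]
      refine (norm_add_le _ _).trans ?_
      have b1 := norm_sub_le (γ ρ - (y + ρ • e)) (γ ρ - γ τ - (ρ - τ) • e)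
      have b2 := (hend ρ (Or.inl rfl)).2
      have b3 := hγe ρ τ
      rw [abs_of_nonneg (by linarith)] at b3
      have b5 : ω * (ρ - τ) ≤ 1 / 4 * (2 * ρ) := by
        apply mul_le_mul hω' (by linarith [hτI.1]) (by linarith [hτI.2]) (by norm_num)
      have b6 : ‖τ • e‖ ≤ ρ := by
        rw [norm_smul, he, Real.norm_eq_abs, mul_one]; exact abs_le.2 hτI
      linarith
    have c1 : |f (γ τ + t • e) - f (y + t • e)| ≤ L * (2 * ρ) :=
      (hL _ _).trans (by gcongr; simpa using hy)
    have c2 : |f (γ τ) - f y| ≤ L * (2 * ρ) := (hL _ _).trans (by gcongr)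
    have c3 : 4 * L * ρ ≤ s0 * n * ρ := by gcongr
    have c4 : s0 * (n * ρ) ≤ S * |t| := by gcongr
    have a0 := mul_nonneg hSpos.le (abs_nonneg t)
    rw [abs_le] at c1 c2 ⊢
    constructor <;> linarith [c1.1, c1.2, c2.1, c2.2]
  push Not at hbig
  by_cases hr : ρ < τ + t
  · have : |t| = t := abs_of_nonneg (by linarith)
    refine case2 ρ (Or.inl rfl) ?_ (by linarith) hbig
    rw [abs_of_nonneg (by linarith)]; linarith
  by_cases hl : τ + t < -ρ
  · have : |t| = -t := abs_of_nonpos (by linarith)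
    refine case2 (-ρ) (Or.inr rfl) ?_ (by linarith) hbig
    rw [abs_of_nonpos (by linarith)]; linarith
  push Not at hr hl
  have a1 := hdH' (τ + t) ⟨hl, hr⟩
  rw [add_sub_cancel_left] at a1
  have a3 : |f (y + t • e) - f y - fd * t| ≤ σ * |t| := hψ t (by nlinarith)
  have a4 := hγe (τ + t) τ
  rw [add_sub_cancel_left] at a4
  have a5 : |f (γ (τ + t)) - f (γ τ + t • e)| ≤ L * (ω * |t|) := by
    refine (hL _ _).trans ?_
    gcongr
    rw [← sub_sub]; exact a4
  have a6 : L * ω * |t| ≤ s0 * |t| := by gcongr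
  have a8 : σ * |t| ≤ s0 * |t| := by gcongr
  have a9 : s0 * |t| ≤ S * |t| := by gcongr
  have a0 := mul_nonneg hSpos.le (abs_nonneg t)
  have heq : (f (γ τ + t • e) - f (γ τ)) - (f (y + t • e) - f y) =
      (H (τ + t) - H τ) - (f (γ (τ + t)) - f (γ τ + t • e)) - (f (y + t • e) - f y - fd * t) := by
    simp only [hH]; ring
  rw [heq]
  rw [abs_le] at a1 a3 a5 ⊢
  constructor <;> linarith [a1.1, a1.2, a3.1, a3.2, a5.1, a5.2]

lemma slope_aux {Y : Type*} [NormedAddCommGroup Y] [NormedSpace ℝ Y]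
    (e : Y) (D : Y →L[ℝ] ℝ) (k ν K r θ c : ℝ) (hk : 0 ≤ k) (hk1 : k ≤ 1)
    (hD : ∀ v : Y, ‖v‖ < ν → ‖e + v‖ ≤ 1 + D v + k * ‖v‖)
    (hK : 0 < K) (hKν : 4 / K < ν) (hr : 0 < r) (hθ : 8 * θ ≤ k / K)
    (hc : K * r / 2 ≤ c) (z q : Y) (hz : ‖z‖ ≤ 2 * r) (hDz : D z = 0)
    (hq : ‖q‖ ≤ 2 * (2 * (K * r) * θ)) :
    ‖e + c⁻¹ • z + c⁻¹ • q‖ ≤ 1 + 5 * k / K ∧ ‖e + c⁻¹ • z + c⁻¹ • q - e‖ ≤ 5 / K := by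
  have hc0 : 0 < c := lt_of_lt_of_le (by positivity) hc
  have h1 : ‖c⁻¹ • z‖ ≤ 4 / K := by
    rw [norm_smul, norm_inv, Real.norm_eq_abs, abs_of_pos hc0, inv_mul_le_iff₀ hc0]
    calc ‖z‖ ≤ 2 * r := hz
      _ = K * r / 2 * (4 / K) := by field_simp; ring
      _ ≤ c * (4 / K) := by gcongr
  have h2 : ‖c⁻¹ • q‖ ≤ k / K := by
    rw [norm_smul, norm_inv, Real.norm_eq_abs, abs_of_pos hc0, inv_mul_le_iff₀ hc0]
    calc ‖q‖ ≤ K * r / 2 * (8 * θ) := by linarith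
      _ ≤ K * r / 2 * (k / K) := by gcongr
      _ ≤ c * (k / K) := by gcongr
  have h3 := hD (c⁻¹ • z) (by linarith)
  rw [map_smul, hDz, smul_zero, add_zero] at h3
  have h4 : k * ‖c⁻¹ • z‖ ≤ k * (4 / K) := by gcongr
  constructor
  · refine (norm_add_le _ _).trans ?_
    have : 5 * k / K = k * (4 / K) + k / K := by ring
    linarith
  · rw [show e + c⁻¹ • z + c⁻¹ • q - e = c⁻¹ • z + c⁻¹ • q by abel]
    refine (norm_add_le _ _).trans ?_
    have : k / K ≤ 1 / K := by gcongr
    have h5 : 5 / K = 4 / K + 1 / K := by ring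
    linarith

set_option maxHeartbeats 4000000 in
theorem statement13 {Y : Type*} [NormedAddCommGroup Y] [NormedSpace ℝ Y]
    (hnorm : ∀ u : Y, u ≠ 0 → DifferentiableAt ℝ (fun v : Y => ‖v‖) u)
    (f : Y → ℝ) (L : NNReal) (hL : LipschitzWith L f)
    (hLmin : ∀ K : NNReal, LipschitzWith K f → L ≤ K)
    (y e : Y) (he : ‖e‖ = 1)
    (fd : ℝ) (hfd : HasDirDeriv f y e fd) (hfd0 : 0 ≤ fd)
    (F : ℝ → Set Y)
    (h1 : ∀ ε > (0:ℝ), ∀ θ > (0:ℝ), ∃ δstar > (0:ℝ), ∀ δ : ℝ, 0 < δ → δ < δstar →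
      IsWedgeApprox (δ * θ) (F ε) (ball y δ))
    (h2 : ∀ ε > (0:ℝ), ∀ y' ∈ F ε, ∀ e' : Y, ‖e'‖ = 1 →
      ∀ fd' : ℝ, HasDirDeriv f y' e' fd' → fd ≤ fd' →
        (∀ t : ℝ, |(f (y' + t • e) - f y') - (f (y + t • e) - f y)| ≤
          25 * Real.sqrt ((fd' - fd) * (L : ℝ)) * |t|) →
        fd' < fd + ε) :
    DifferentiableAt ℝ f y := by
  rcases eq_or_lt_of_le (zero_le (a := L)) with hL0 | hL0
  · have hconst : f = fun _ => f y := by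
      ext x
      have := hL.dist_le_mul x y
      rw [← hL0] at this
      have h3 : dist (f x) (f y) ≤ 0 := by simpa using this
      exact dist_le_zero.1 h3
    rw [hconst]
    exact differentiableAt_const _
  have hLr : (0 : ℝ) < L := hL0
  generalize hl : (L : ℝ) = l at *
  have hLip : ∀ x z, |f x - f z| ≤ l * ‖x - z‖ := by
    intro x z
    have := hL.dist_le_mul x z
    rwa [Real.dist_eq, dist_eq_norm, hl] at this
  have he0 : e ≠ 0 := by
    intro h; rw [h] at he; simp at he
  have hder := hasDerivAt_of_hasDirDeriv f y e fd hfd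
  have hfdl : fd ≤ l := by
    refine (le_abs_self fd).trans ?_
    have := hder.le_of_lip' hLr.le (Eventually.of_forall fun t => by
      have := hLip (y + t • e) (y + (0:ℝ) • e)
      simpa [norm_smul, he] using this)
    simpa using this
  set D := fderiv ℝ (fun v : Y => ‖v‖) e with hDdef
  have hD : HasFDerivAt (fun v : Y => ‖v‖) D e := (hnorm e he0).hasFDerivAt
  have hDe : D e = 1 := by
    rw [hDdef, (hnorm e he0).fderiv_norm_self, he]
  have hDn : ∀ u, |D u| ≤ ‖u‖ := by
    intro u
    have h3 : ‖D‖ ≤ (1 : NNReal) := hD.le_of_lipschitz lipschitzWith_one_norm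
    have := D.le_of_opNorm_le h3 u
    simpa using this
  suffices hmain : HasFDerivAt f (fd • D) y from hmain.differentiableAt
  rw [hasFDerivAt_iff_isLittleO_nhds_zero]
  by_contra hcon
  rw [Asymptotics.isLittleO_iff] at hcon
  push Not at hcon
  obtain ⟨η, hη, hfreq⟩ := hcon
  -- parameters
  obtain ⟨k, hk⟩ : ∃ k, k = min (η / (1200 * l)) (1 / 50) := ⟨_, rfl⟩
  have hk0 : 0 < k := by rw [hk]; positivity
  have hk1 : k ≤ η / (1200 * l) := by rw [hk]; exact min_le_left _ _
  have hk2 : k ≤ 1 / 50 := by rw [hk]; exact min_le_right _ _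
  obtain ⟨ν, hν0, hν⟩ : ∃ ν > 0, ∀ v : Y, ‖v‖ < ν → ‖e + v‖ ≤ 1 + D v + k * ‖v‖ := by
    rw [hasFDerivAt_iff_isLittleO_nhds_zero, Asymptotics.isLittleO_iff] at hD
    obtain ⟨ν, hν0, hν⟩ := Metric.eventually_nhds_iff.1 (hD hk0)
    refine ⟨ν, hν0, fun v hv => ?_⟩
    have := hν (y := v) (by simpa using hv)
    rw [he, Real.norm_eq_abs] at this
    linarith [(abs_le.1 this).2]
  obtain ⟨K, hK⟩ : ∃ K, K = 20 + 1200 * l / η + 5 / ν := ⟨_, rfl⟩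
  have hq1 : 0 < 1200 * l / η := by positivity
  have hq2 : 0 < 5 / ν := by positivity
  have hK20 : 20 ≤ K := by linarith
  have hK0 : 0 < K := by linarith
  have hKη : 1200 * l ≤ K * η := by
    rw [← div_le_iff₀ hη]; linarith
  have hKν : 4 / K < ν := by
    rw [div_lt_iff₀ hK0]
    have : 5 / ν < K := by linarith
    rw [div_lt_iff₀ hν0] at this
    linarith
  obtain ⟨d0, hd0⟩ : ∃ d0, d0 = η / (24 * K) := ⟨_, rfl⟩
  have hd0pos : 0 < d0 := by rw [hd0]; positivity
  obtain ⟨s0, hs0⟩ : ∃ s0, s0 = Real.sqrt (d0 * l / 2) := ⟨_, rfl⟩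
  have hs0pos : 0 < s0 := by rw [hs0]; positivity
  have hs0sq : s0 ^ 2 = d0 * l / 2 := by rw [hs0]; exact Real.sq_sqrt (by positivity)
  obtain ⟨A, hA⟩ : ∃ A, A = min (η / 8) (s0 * η / (72 * l)) := ⟨_, rfl⟩
  have hA0 : 0 < A := by rw [hA]; positivity
  have hA1 : A ≤ η / 8 := by rw [hA]; exact min_le_left _ _
  have hA2 : A ≤ s0 * η / (72 * l) := by rw [hA]; exact min_le_right _ _
  obtain ⟨σ, hσ⟩ : ∃ σ, σ = min s0 (A / (4 * K)) := ⟨_, rfl⟩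
  have hσ0 : 0 < σ := by rw [hσ]; positivity
  have hσ1 : σ ≤ s0 := by rw [hσ]; exact min_le_left _ _
  have hσ2 : σ * (4 * K) ≤ A := by
    rw [← le_div_iff₀ (by positivity), hσ]; exact min_le_right _ _
  obtain ⟨θ, hθ⟩ : ∃ θ, θ = min (min (1 / 4) (k / (8 * K))) (A / (8 * l * K)) := ⟨_, rfl⟩
  have hθ0 : 0 < θ := by rw [hθ]; positivity
  have hθ1 : θ ≤ 1 / 4 := by rw [hθ]; exact (min_le_left _ _).trans (min_le_left _ _)
  have hθ2 : 8 * θ ≤ k / K := by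
    have : θ ≤ k / (8 * K) := by rw [hθ]; exact (min_le_left _ _).trans (min_le_right _ _)
    have h3 : k / K = 8 * (k / (8 * K)) := by field_simp
    linarith
  have hθ3 : θ * (8 * l * K) ≤ A := by
    rw [← le_div_iff₀ (by positivity), hθ]; exact min_le_right _ _
  obtain ⟨n, hn⟩ : ∃ n, n = 2 + 4 * l / s0 := ⟨_, rfl⟩
  have hq3 : 0 < 4 * l / s0 := by positivity
  have hn2 : 2 ≤ n := by linarith
  have hn4 : 4 * l ≤ s0 * n := by
    have : 4 * l / s0 ≤ n := by linarith
    rw [div_le_iff₀ hs0pos] at this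
    linarith
  obtain ⟨δσ, hδσ0, hδσ⟩ : ∃ δ > 0, ∀ t : ℝ, |t| < δ → |f (y + t • e) - f y - fd * t| ≤ σ * |t| := by
    rw [hasDerivAt_iff_isLittleO_nhds_zero, Asymptotics.isLittleO_iff] at hder
    obtain ⟨δ, hδ0, hδ⟩ := Metric.eventually_nhds_iff.1 (hder hσ0)
    refine ⟨δ, hδ0, fun t ht => ?_⟩
    have := hδ (y := t) (by simpa using ht)
    simpa [mul_comm] using this
  obtain ⟨δs, hδs0, hδs⟩ := h1 (d0 / 2) (by positivity) θ hθ0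
  -- the bad point
  have hev : ∀ᶠ u : Y in nhds 0, ‖u‖ < min (δσ / ((n + 1) * K)) (δs / (2 * K)) := by
    have := Metric.ball_mem_nhds (0 : Y)
      (show 0 < min (δσ / ((n + 1) * K)) (δs / (2 * K)) by positivity)
    filter_upwards [this] with u hu
    simpa using hu
  obtain ⟨u, hu, husmall⟩ := (hfreq.and_eventually hev).exists
  obtain ⟨r, hr⟩ : ∃ r, r = ‖u‖ := ⟨_, rfl⟩
  obtain ⟨ξ, hξ⟩ : ∃ ξ, ξ = D u := ⟨_, rfl⟩
  have hu' : η * r < |f (y + u) - f y - fd * ξ| := by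
    rw [hr, hξ]; simpa using hu
  have hr0 : 0 < r := by
    have h3 : 0 ≤ r := by rw [hr]; positivity
    rcases h3.eq_or_lt with h | h
    · exfalso
      have hu0 : u = 0 := by rw [← norm_eq_zero, ← hr, ← h]
      rw [hξ, hu0] at hu'
      simp [← h] at hu'
    · exact h
  rw [← hr] at husmall
  have hr1 : (n + 1) * (K * r) < δσ := by
    have := husmall.trans_le (min_le_left _ _)
    rw [lt_div_iff₀ (by positivity)] at this
    linarith
  have hr2 : 2 * (K * r) < δs := by
    have := husmall.trans_le (min_le_right _ _)
    rw [lt_div_iff₀ (by positivity)] at this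
    linarith
  have hξr : |ξ| ≤ r := by rw [hξ, hr]; exact hDn u
  have hKr : 20 * r ≤ K * r := by gcongr
  obtain ⟨hξ1, hξ2⟩ := abs_le.1 hξr
  have hKr0 : 0 < K * r := by positivity
  obtain ⟨⟨p1, p2, p3⟩, hpF, hpd⟩ := hδs (2 * (K * r)) (by positivity) hr2
    (y - (K * r) • e, y + u, y + (K * r) • e) (by
      have c1 : y - (K * r) • e ∈ ball y (2 * (K * r)) := by
        rw [mem_ball, dist_eq_norm, sub_sub_cancel_left, norm_neg, norm_smul, he, mul_one,
          Real.norm_eq_abs, abs_of_pos hKr0]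
        linarith
      have c2 : y + u ∈ ball y (2 * (K * r)) := by
        rw [mem_ball, dist_eq_norm, add_sub_cancel_left, ← hr]
        linarith
      have c3 : y + (K * r) • e ∈ ball y (2 * (K * r)) := by
        rw [mem_ball, dist_eq_norm, add_sub_cancel_left, norm_smul, he, mul_one,
          Real.norm_eq_abs, abs_of_pos hKr0]
        linarith
      exact union_subset ((convex_ball _ _).segment_subset c1 c2)
        ((convex_ball _ _).segment_subset c2 c3))
  unfold wedgeDist at hpd
  simp only [max_le_iff] at hpd
  obtain ⟨hp1, hp2, hp3⟩ := hpd
  have hz : ‖u - ξ • e‖ ≤ 2 * r := by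
    refine (norm_sub_le _ _).trans ?_
    rw [norm_smul, he, Real.norm_eq_abs, ← hr]; linarith
  have hDz : D (u - ξ • e) = 0 := by
    rw [map_sub, map_smul, hDe, ← hξ]; simp
  have hc1 : 0 < ξ + K * r := by linarith
  have hc2 : 0 < K * r - ξ := by linarith
  have hs1 := slope_aux e D k ν K r θ (ξ + K * r) hk0.le (by linarith) hν hK0 hKν hr0 hθ2
    (by linarith) (u - ξ • e) ((p2 - (y + u)) - (p1 - (y - (K * r) • e))) hz hDz
    ((norm_sub_le _ _).trans (by linarith))
  have hs2 := slope_aux e D k ν K r θ (K * r - ξ) hk0.le (by linarith) hν hK0 hKν hr0 hθ2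
    (by linarith) (ξ • e - u) ((p3 - (y + (K * r) • e)) - (p2 - (y + u)))
    (by rw [norm_sub_rev]; exact hz) (by rw [← neg_sub, map_neg, hDz, neg_zero])
    ((norm_sub_le _ _).trans (by linarith))
  have hlα : l * (2 * (K * r) * θ) ≤ A * r / 4 := by nlinarith
  have hσρ : σ * (K * r) ≤ A * r / 4 := by nlinarith
  have hAr1 : A * r ≤ η / 8 * r := by gcongr
  have hAr2 : A * r ≤ s0 * (η * r / (72 * l)) := by
    calc A * r ≤ s0 * η / (72 * l) * r := by gcongr
      _ = _ := by ring
  have hp2f : |f p2 - f (y + u)| ≤ A * r / 4 :=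
    (hLip _ _).trans (le_trans (by gcongr) hlα)
  obtain ⟨v1, hv1⟩ : ∃ v, v = e + (ξ + K * r)⁻¹ • (u - ξ • e) +
    (ξ + K * r)⁻¹ • ((p2 - (y + u)) - (p1 - (y - (K * r) • e))) := ⟨_, rfl⟩
  obtain ⟨v2, hv2⟩ : ∃ v, v = e + (K * r - ξ)⁻¹ • (ξ • e - u) +
    (K * r - ξ)⁻¹ • ((p3 - (y + (K * r) • e)) - (p2 - (y + u))) := ⟨_, rfl⟩
  rw [← hv1] at hs1
  rw [← hv2] at hs2
  have g1 : p1 = p2 - (ξ + K * r) • v1 := by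
    rw [hv1, smul_add, smul_add, smul_smul, smul_smul, mul_inv_cancel₀ hc1.ne']
    module
  have g2 : p3 = p2 + (K * r - ξ) • v2 := by
    rw [hv2, smul_add, smul_add, smul_smul, smul_smul, mul_inv_cancel₀ hc2.ne']
    module
  have hηr : 0 < η * r := by positivity
  have g3 : σ * (K * r) + l * (2 * (K * r) * θ) ≤ η * r / 2 / 4 := by linarith
  have g4 : 3 * (η * r / 2) / 2 ≤ |f p2 - fd * ξ - f y| := by
    have h3 := abs_sub_abs_le_abs_sub (f (y + u) - f y - fd * ξ) (f (y + u) - f p2)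
    rw [abs_sub_comm] at hp2f
    have h4 : f (y + u) - f y - fd * ξ - (f (y + u) - f p2) = f p2 - fd * ξ - f y := by ring
    rw [h4] at h3
    linarith
  have g5 : d0 = η * r / 2 / (12 * (K * r)) := by
    rw [hd0]; field_simp; norm_num
  have g6 : 5 * k / K ≤ 1 / 10 := by rw [div_le_iff₀ hK0]; linarith
  have g7 : 5 * k / K * l ≤ d0 / 10 := by
    rw [hd0]
    calc 5 * k / K * l ≤ 5 * (η / (1200 * l)) / K * l := by gcongr
      _ = η / (24 * K) / 10 := by field_simp; norm_num
  have g8 : l * (5 / K) ≤ s0 := by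
    refine le_of_sq_le_sq ?_ hs0pos.le
    rw [hs0sq, hd0]
    rw [show (l * (5 / K)) ^ 2 = 25 * l * l / K ^ 2 by ring,
      show η / (24 * K) * l / 2 = (η * K * l / 48) / K ^ 2 by field_simp; norm_num]
    gcongr
    nlinarith
  have g9 : 5 / K ≤ 1 / 4 := by rw [div_le_iff₀ hK0]; linarith
  have g10 : 2 * (η * r / (72 * l)) ≤ η * r / 2 / (18 * l) := by
    apply le_of_eq; field_simp; norm_num
  have g11 : 2 * l * (2 * (K * r) * θ) + 2 * σ * (K * r) ≤ s0 * (η * r / (72 * l)) := by linarith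
  have g12 : 2 * (K * r) * θ ≤ K * r / 2 := by
    have : 2 * (K * r) * θ ≤ 2 * (K * r) * (1 / 4) := by gcongr
    linarith
  have g13 : 0 < η * r / (72 * l) := by positivity
  have g14 : 0 ≤ 5 * k / K := by positivity
  obtain ⟨y', hy', e', he', fd', hdir, hfd', hineq⟩ := core_s13 f l hLr hLip y e he fd hfd0 hfdl
    (K * r) ξ (2 * (K * r) * θ) (5 * k / K) (5 / K) σ (η * r / 2) d0 s0 (η * r / (72 * l)) n
    hKr0 (by linarith) p1 p2 p3 hp1 hp3 v1 v2 g1 g2 hs1.1 hs2.1 hs1.2 hs2.2 (by linarith) g3 g4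
    g5 g14 g6 g7 hs0pos hs0sq.le g8 g9 hσ0.le hσ1 g13 g10 g11 g12 (by linarith) hn4 hn2
    (fun t ht => hδσ t (by linarith))
  have := h2 (d0 / 2) (by positivity) y' (hpF hy') e' he' fd' hdir (by linarith) hineq
  linarith
end
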